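/- Let (α,z) be in the data-processing region D with |1−α|/z = 1, let ρ₁ and ρ₂ be quantum states of dimensions d₁ and d₂, let {S_d}_{d≥1} satisfy Assumption 1′, and suppose S_{d₁} contains a state whose support contains supp(ρ₁) and S_{d₂} contains a state whose support contains supp(ρ₂). Then min_{σ ∈ S_{d₁d₂}} D_{α,z}(ρ₁ ⊗ ρ₂‖σ) = min_{σ ∈ S_{d₁}} D_{α,z}(ρ₁‖σ) + min_{σ ∈ S_{d₂}} D_{α,z}(ρ₂‖σ). -/

import Mathlib

open scoped BigOperators ComplexOrder Classical
open MeasureTheory Filter Set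

noncomputable section

namespace QHT

variable {ι : Type*} [Fintype ι] [DecidableEq ι]

/-- Generalized matrix power `A ^ w` (complex exponent `w`) of a Hermitian matrix,
via functional calculus on the support: the eigenvalue `0` is mapped to `0`. -/
def mpow (A : Matrix ι ι ℂ) (w : ℂ) : Matrix ι ι ℂ :=
  if hA : A.IsHermitian then
    (hA.eigenvectorUnitary : Matrix ι ι ℂ) *
      Matrix.diagonal (fun i => if hA.eigenvalues i = 0 then 0 else (hA.eigenvalues i : ℂ) ^ w) *
      star (hA.eigenvectorUnitary : Matrix ι ι ℂ)
  else 0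

/-- Matrix logarithm of a Hermitian matrix, taken on its support
(`Real.log 0 = 0`, so the kernel is mapped to `0`). -/
def mlog (A : Matrix ι ι ℂ) : Matrix ι ι ℂ :=
  if hA : A.IsHermitian then
    (hA.eigenvectorUnitary : Matrix ι ι ℂ) *
      Matrix.diagonal (fun i => (Real.log (hA.eigenvalues i) : ℂ)) *
      star (hA.eigenvectorUnitary : Matrix ι ι ℂ)
  else 0

/-- The support of a matrix, i.e. its range as a linear map. -/
def msupp (A : Matrix ι ι ℂ) : Submodule ℂ (ι → ℂ) := LinearMap.range A.mulVecLin

/-- A quantum state: a positive semidefinite matrix of trace one. -/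
def IsState (A : Matrix ι ι ℂ) : Prop := A.PosSemidef ∧ A.trace = 1

/-- Real part of the trace. -/
def rtr (A : Matrix ι ι ℂ) : ℝ := A.trace.re

/-- The Umegaki relative entropy `D(ρ‖σ)`, with value `+∞` when `supp ρ ⊄ supp σ`. -/
def relEnt (ρ σ : Matrix ι ι ℂ) : EReal :=
  if msupp ρ ≤ msupp σ then ((rtr (ρ * (mlog ρ - mlog σ)) : ℝ) : EReal) else ⊤

/-- The polar of a set of matrices (intersected with the PSD cone). -/
def polar (S : Set (Matrix ι ι ℂ)) : Set (Matrix ι ι ℂ) :=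
  {X | X.PosSemidef ∧ ∀ Y ∈ S, rtr (X * Y) ≤ 1}

/-- Entrywise Bochner integral of a matrix-valued function over `ℝ`. -/
def mInt (f : ℝ → Matrix ι ι ℂ) : Matrix ι ι ℂ :=
  Matrix.of fun i j => ∫ t : ℝ, f t i j

/-- Entrywise Bochner integral of a matrix-valued function over a set `s ⊆ ℝ`. -/
def mIntOn (f : ℝ → Matrix ι ι ℂ) (s : Set ℝ) : Matrix ι ι ℂ :=
  Matrix.of fun i j => ∫ t in s, f t i j

/-- `sinc` function. -/
def sinc (s : ℝ) : ℝ := if s = 0 then 1 else Real.sin s / s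

/-- The probability density `β_θ` from the paper (`β₀` is the `θ → 0` limit). -/
def betaDist (θ t : ℝ) : ℝ :=
  if θ = 0 then Real.pi / (2 * (Real.cosh (Real.pi * t) + 1))
  else Real.sin (θ * Real.pi) / (2 * θ * (Real.cosh (Real.pi * t) + Real.cos (θ * Real.pi)))

/-- `Q_{α,z}(ρ‖σ) = Tr[(ρ^{α/2z} σ^{(1-α)/z} ρ^{α/2z})^z]`. -/
def Qaz (α z : ℝ) (ρ σ : Matrix ι ι ℂ) : ℝ :=
  rtr (mpow (mpow ρ ((α / (2 * z) : ℝ) : ℂ) * mpow σ (((1 - α) / z : ℝ) : ℂ) *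
      mpow ρ ((α / (2 * z) : ℝ) : ℂ)) ((z : ℝ) : ℂ))

/-- The `α`-`z` Rényi relative entropy. -/
def Daz (α z : ℝ) (ρ σ : Matrix ι ι ℂ) : EReal :=
  if (α < 1 ∧ (ρ * σ).trace ≠ 0) ∨ msupp ρ ≤ msupp σ then
    (((α - 1)⁻¹ * Real.log (Qaz α z ρ σ) : ℝ) : EReal)
  else ⊤

/-- `Q_α(ρ‖σ) = Tr[ρ^α σ^{1-α}]` (Petz). -/
def Qpetz (α : ℝ) (ρ σ : Matrix ι ι ℂ) : ℝ :=
  rtr (mpow ρ ((α : ℝ) : ℂ) * mpow σ (((1 - α) : ℝ) : ℂ))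

/-- The Petz Rényi divergence. -/
def Dpetz (α : ℝ) (ρ σ : Matrix ι ι ℂ) : EReal :=
  if (α < 1 ∧ (ρ * σ).trace ≠ 0) ∨ msupp ρ ≤ msupp σ then
    (((α - 1)⁻¹ * Real.log (Qpetz α ρ σ) : ℝ) : EReal)
  else ⊤

/-- `Q̃_α(ρ‖σ) = Tr[(σ^{(1-α)/2α} ρ σ^{(1-α)/2α})^α]` (sandwiched). -/
def Qsand (α : ℝ) (ρ σ : Matrix ι ι ℂ) : ℝ :=
  rtr (mpow (mpow σ (((1 - α) / (2 * α) : ℝ) : ℂ) * ρ * mpow σ (((1 - α) / (2 * α) : ℝ) : ℂ))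
    ((α : ℝ) : ℂ))

/-- The sandwiched Rényi divergence. -/
def Dsand (α : ℝ) (ρ σ : Matrix ι ι ℂ) : EReal :=
  if (α < 1 ∧ (ρ * σ).trace ≠ 0) ∨ msupp ρ ≤ msupp σ then
    (((α - 1)⁻¹ * Real.log (Qsand α ρ σ) : ℝ) : EReal)
  else ⊤

/-- `D̃_∞(ρ‖σ)`: the limit of `D̃_α(ρ‖σ)` as `α → +∞` (encoded as a `limsup`; the limit
exists by monotonicity in `α`). -/
def DsandInf (ρ σ : Matrix ι ι ℂ) : EReal :=
  Filter.limsup (fun α : ℝ => Dsand α ρ σ) Filter.atTop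

/-- `χ_{α,z}(ρ,σ) = ρ^{α/2z} (ρ^{α/2z} σ^{(1-α)/z} ρ^{α/2z})^{z-1} ρ^{α/2z}`. -/
def chi (α z : ℝ) (ρ σ : Matrix ι ι ℂ) : Matrix ι ι ℂ :=
  mpow ρ ((α / (2 * z) : ℝ) : ℂ) *
    mpow (mpow ρ ((α / (2 * z) : ℝ) : ℂ) * mpow σ (((1 - α) / z : ℝ) : ℂ) *
      mpow ρ ((α / (2 * z) : ℝ) : ℂ)) (((z - 1 : ℝ)) : ℂ) *
    mpow ρ ((α / (2 * z) : ℝ) : ℂ)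

/-- The data-processing region `𝒟` for `α`-`z` Rényi relative entropies. -/
def Dregion : Set (ℝ × ℝ) :=
  {p | (0 < p.1 ∧ p.1 < 1 ∧ max p.1 (1 - p.1) ≤ p.2) ∨
       (1 < p.1 ∧ max (p.1 / 2) (p.1 - 1) ≤ p.2 ∧ p.2 ≤ p.1) ∨
       (p.1 = 1 ∧ 0 < p.2)}

end QHT

namespace QHT

variable {ι : Type*} [Fintype ι] [DecidableEq ι]

/-! ### Tensor products and many copies -/

/-- Tensor product of a `d₁`- and a `d₂`-dimensional operator, as a `d₁d₂`-dimensional one. -/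
def dtens {a b : ℕ} (A : Matrix (Fin a) (Fin a) ℂ) (B : Matrix (Fin b) (Fin b) ℂ) :
    Matrix (Fin (a * b)) (Fin (a * b)) ℂ :=
  Matrix.of fun x y =>
    A (finProdFinEquiv.symm x).1 (finProdFinEquiv.symm y).1 *
      B (finProdFinEquiv.symm x).2 (finProdFinEquiv.symm y).2

/-- `ρ^{⊗n}` of a `d`-dimensional operator, as a `d^n`-dimensional operator. -/
def dpow {d : ℕ} (ρ : Matrix (Fin d) (Fin d) ℂ) (n : ℕ) :
    Matrix (Fin (d ^ n)) (Fin (d ^ n)) ℂ :=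
  Matrix.of fun x y => ∏ i, ρ (finFunctionFinEquiv.symm x i) (finFunctionFinEquiv.symm y i)

/-- The action of a permutation of the `k` tensor factors on an operator on `(ℂ^d)^{⊗k}`. -/
def permMat (d k : ℕ) (π : Equiv.Perm (Fin k)) (A : Matrix (Fin (d ^ k)) (Fin (d ^ k)) ℂ) :
    Matrix (Fin (d ^ k)) (Fin (d ^ k)) ℂ :=
  Matrix.of fun x y =>
    A (finFunctionFinEquiv ((finFunctionFinEquiv.symm x) ∘ π))
      (finFunctionFinEquiv ((finFunctionFinEquiv.symm y) ∘ π))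

/-- `ρ^{⊗n}` of a `d`-dimensional operator, as an operator on `H^{⊗n}` with `H = ℂ^d`,
indexed by tuples. -/
def tpow {d : ℕ} (ρ : Matrix (Fin d) (Fin d) ℂ) (n : ℕ) :
    Matrix (Fin n → Fin d) (Fin n → Fin d) ℂ :=
  Matrix.of fun x y => ∏ i, ρ (x i) (y i)

/-- Tensor product of an operator on `H^{⊗m}` and an operator on `H^{⊗n}`, as an
operator on `H^{⊗(m+n)}`. -/
def tensOp {d m n : ℕ} (A : Matrix (Fin m → Fin d) (Fin m → Fin d) ℂ)
    (B : Matrix (Fin n → Fin d) (Fin n → Fin d) ℂ) :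
    Matrix (Fin (m + n) → Fin d) (Fin (m + n) → Fin d) ℂ :=
  Matrix.of fun x y =>
    A (fun i => x (Fin.castAdd n i)) (fun i => y (Fin.castAdd n i)) *
      B (fun j => x (Fin.natAdd m j)) (fun j => y (Fin.natAdd m j))

/-- Permutation action on operators on `H^{⊗k}`. -/
def permOp {d k : ℕ} (π : Equiv.Perm (Fin k))
    (A : Matrix (Fin k → Fin d) (Fin k → Fin d) ℂ) :
    Matrix (Fin k → Fin d) (Fin k → Fin d) ℂ :=
  Matrix.of fun x y => A (x ∘ π) (y ∘ π)

/-! ### Hypothesis testing -/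

/-- A test: an operator `T` with `0 ≤ T ≤ I`. -/
def IsTest (T : Matrix ι ι ℂ) : Prop := T.PosSemidef ∧ (1 - T).PosSemidef

/-- Type I error `α_n(ρ|T) = Tr[(I - T) ρ^{⊗n}]`. -/
def typeI {d : ℕ} (ρ : Matrix (Fin d) (Fin d) ℂ) (n : ℕ)
    (T : Matrix (Fin n → Fin d) (Fin n → Fin d) ℂ) : ℝ :=
  rtr ((1 - T) * tpow ρ n)

/-- Type II error `β_n(S|T) = sup_{σ ∈ S} Tr[σ T]`. -/
def typeII {d n : ℕ} (S : Set (Matrix (Fin n → Fin d) (Fin n → Fin d) ℂ))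
    (T : Matrix (Fin n → Fin d) (Fin n → Fin d) ℂ) : ℝ :=
  sSup ((fun σ => rtr (σ * T)) '' S)

/-- `- log x`, valued in `EReal`, with `- log x = +∞` for `x ≤ 0`. -/
def negLog (x : ℝ) : EReal := if x ≤ 0 then ⊤ else ((- Real.log x : ℝ) : EReal)

/-- The exponential rate `-(1/n) log x`. -/
def rate (n : ℕ) (x : ℝ) : EReal := (((n : ℝ)⁻¹ : ℝ) : EReal) * negLog x

/-- The Stein exponent `s(ρ‖{S_n})`. -/
def steinExp {d : ℕ} (ρ : Matrix (Fin d) (Fin d) ℂ)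
    (S : (n : ℕ) → Set (Matrix (Fin n → Fin d) (Fin n → Fin d) ℂ)) : EReal :=
  sSup ((fun r : ℝ => (r : EReal)) ''
    {r : ℝ | 0 ≤ r ∧ ∃ T : (n : ℕ) → Matrix (Fin n → Fin d) (Fin n → Fin d) ℂ,
      (∀ n, IsTest (T n)) ∧
      (r : EReal) ≤ Filter.liminf (fun n => rate n (typeII (S n) (T n))) Filter.atTop ∧
      Filter.Tendsto (fun n => typeI ρ n (T n)) Filter.atTop (nhds 0)})

/-- The Chernoff exponent `c(ρ‖{S_n})`. -/
def chernoffExp {d : ℕ} (ρ : Matrix (Fin d) (Fin d) ℂ)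
    (S : (n : ℕ) → Set (Matrix (Fin n → Fin d) (Fin n → Fin d) ℂ)) : EReal :=
  Filter.liminf (fun n =>
    rate n (sInf ((fun T => typeI ρ n T + typeII (S n) T) '' {T | IsTest T}))) Filter.atTop

/-- The Hoeffding (direct) exponent `d_r(ρ‖{S_n})`. -/
def hoeffdingExp {d : ℕ} (r : ℝ) (ρ : Matrix (Fin d) (Fin d) ℂ)
    (S : (n : ℕ) → Set (Matrix (Fin n → Fin d) (Fin n → Fin d) ℂ)) : EReal :=
  ⨆ T : {T : (n : ℕ) → Matrix (Fin n → Fin d) (Fin n → Fin d) ℂ //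
      (∀ n, IsTest (T n)) ∧
      (r : EReal) ≤ Filter.liminf (fun n => rate n (typeII (S n) (T n))) Filter.atTop},
    Filter.liminf (fun n => rate n (typeI ρ n (T.1 n))) Filter.atTop

/-- The strong converse exponent `sc_r(ρ‖{S_n})`. -/
def scExp {d : ℕ} (r : ℝ) (ρ : Matrix (Fin d) (Fin d) ℂ)
    (S : (n : ℕ) → Set (Matrix (Fin n → Fin d) (Fin n → Fin d) ℂ)) : EReal :=
  ⨅ T : {T : (n : ℕ) → Matrix (Fin n → Fin d) (Fin n → Fin d) ℂ //
      (∀ n, IsTest (T n)) ∧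
      (r : EReal) ≤ Filter.liminf (fun n => rate n (typeII (S n) (T n))) Filter.atTop},
    Filter.limsup (fun n => rate n (1 - typeI ρ n (T.1 n))) Filter.atTop

/-- Assumption 1 of the paper for a family `{S_n}_{n ≥ 1}` of sets of operators
on `H^{⊗n}`, `H = ℂ^d`: each `S_n` is a convex compact set of positive semidefinite
operators, closed under tensor products, and with polar sets closed under tensor
products. -/
structure Assumption1 {d : ℕ}
    (S : (n : ℕ) → Set (Matrix (Fin n → Fin d) (Fin n → Fin d) ℂ)) : Prop where
  psd : ∀ n, 1 ≤ n → ∀ X ∈ S n, X.PosSemidef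
  convex : ∀ n, 1 ≤ n → Convex ℝ (S n)
  compact : ∀ n, 1 ≤ n → IsCompact (S n)
  tens : ∀ m n, 1 ≤ m → 1 ≤ n → ∀ A ∈ S m, ∀ B ∈ S n, tensOp A B ∈ S (m + n)
  polarTens : ∀ m n, 1 ≤ m → 1 ≤ n →
    ∀ A ∈ polar (S m), ∀ B ∈ polar (S n), tensOp A B ∈ polar (S (m + n))

/-- Assumption 1′ of the paper for a dimension-indexed family `{S_d}_{d ≥ 1}`. -/
structure Assumption1' (S : (d : ℕ) → Set (Matrix (Fin d) (Fin d) ℂ)) : Prop where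
  psd : ∀ d, 1 ≤ d → ∀ X ∈ S d, X.PosSemidef
  convex : ∀ d, 1 ≤ d → Convex ℝ (S d)
  compact : ∀ d, 1 ≤ d → IsCompact (S d)
  tens : ∀ d₁ d₂, 1 ≤ d₁ → 1 ≤ d₂ → ∀ A ∈ S d₁, ∀ B ∈ S d₂, dtens A B ∈ S (d₁ * d₂)
  polarTens : ∀ d₁ d₂, 1 ≤ d₁ → 1 ≤ d₂ →
    ∀ A ∈ polar (S d₁), ∀ B ∈ polar (S d₂), dtens A B ∈ polar (S (d₁ * d₂))

end QHT

namespace QHT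

open Matrix Topology
open scoped Matrix.Norms.L2Operator

section Trace

variable {ι : Type*} [Fintype ι]

/-! ### Traces -/

theorem rtr_add (A B : Matrix ι ι ℂ) : rtr (A + B) = rtr A + rtr B := by
  simp [rtr]

theorem rtr_sub (A B : Matrix ι ι ℂ) : rtr (A - B) = rtr A - rtr B := by
  simp [rtr]

theorem rtr_neg (A : Matrix ι ι ℂ) : rtr (-A) = -rtr A := by
  simp [rtr]

theorem rtr_smul (r : ℝ) (A : Matrix ι ι ℂ) : rtr (r • A) = r * rtr A := by
  simp [rtr]

theorem rtr_mul_comm (A B : Matrix ι ι ℂ) : rtr (A * B) = rtr (B * A) := by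
  simp [rtr, trace_mul_comm A B]

theorem continuous_rtr : Continuous (rtr : Matrix ι ι ℂ → ℝ) :=
  Complex.continuous_re.comp (continuous_id.matrix_trace)

theorem rtr_nonneg {A : Matrix ι ι ℂ} (hA : A.PosSemidef) : 0 ≤ rtr A :=
  (Complex.le_def.1 hA.trace_nonneg).1

theorem trace_eq_rtr {A : Matrix ι ι ℂ} (hA : A.PosSemidef) : A.trace = rtr A := by
  have h := Complex.le_def.1 hA.trace_nonneg
  exact Complex.ext (by simp [rtr]) (by simpa using h.2.symm)

theorem eq_zero_of_rtr_eq_zero {A : Matrix ι ι ℂ} (hA : A.PosSemidef) (h : rtr A = 0) : A = 0 := by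
  rw [← hA.trace_eq_zero_iff, trace_eq_rtr hA, h, Complex.ofReal_zero]

end Trace

section General

variable {ι : Type*} [Fintype ι] [DecidableEq ι]

/-! ### Functional calculus through diagonalizations -/

theorem intertwine_diagonal {κ : Type*} [Fintype κ] [DecidableEq κ] {W : Matrix ι κ ℂ}
    {a : ι → ℝ} {b : κ → ℝ}
    (h : W * diagonal (fun j => (b j : ℂ)) = diagonal (fun i => (a i : ℂ)) * W) (f : ℝ → ℝ) :
    W * diagonal (fun j => (f (b j) : ℂ)) = diagonal (fun i => (f (a i) : ℂ)) * W := by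
  ext i j
  have hij := congrFun (congrFun h i) j
  rw [mul_diagonal, diagonal_mul] at hij ⊢
  by_cases hW : W i j = 0
  · simp [hW]
  · have : (b j : ℂ) = a i := mul_left_cancel₀ hW (by rw [hij]; ring)
    rw [Complex.ofReal_injective this]
    ring

theorem cfc_eq_eigen {A : Matrix ι ι ℂ} (hA : A.IsHermitian) (f : ℝ → ℝ) :
    cfc f A = (hA.eigenvectorUnitary : Matrix ι ι ℂ) *
      diagonal (fun i => (f (hA.eigenvalues i) : ℂ)) *
      star (hA.eigenvectorUnitary : Matrix ι ι ℂ) := by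
  rw [hA.cfc_eq, IsHermitian.cfc, Unitary.conjStarAlgAut_apply]
  rfl

theorem eq_eigen {A : Matrix ι ι ℂ} (hA : A.IsHermitian) :
    A = (hA.eigenvectorUnitary : Matrix ι ι ℂ) *
      diagonal (fun i => (hA.eigenvalues i : ℂ)) *
      star (hA.eigenvectorUnitary : Matrix ι ι ℂ) := by
  conv_lhs => rw [hA.spectral_theorem, Unitary.conjStarAlgAut_apply]
  rfl

theorem cfc_unitary_conj_diagonal {U : Matrix ι ι ℂ} (hU : star U * U = 1) (a : ι → ℝ)
    (f : ℝ → ℝ) :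
    cfc f (U * diagonal (fun i => (a i : ℂ)) * star U) =
      U * diagonal (fun i => (f (a i) : ℂ)) * star U := by
  have hU' : U * star U = 1 := mul_eq_one_comm.mp hU
  set A := U * diagonal (fun i => (a i : ℂ)) * star U with hAdef
  have hA : A.IsHermitian := by
    rw [hAdef, IsHermitian, conjTranspose_mul, conjTranspose_mul, ← star_eq_conjTranspose,
      ← star_eq_conjTranspose, ← star_eq_conjTranspose, star_star, star_eq_conjTranspose (diagonal _),
      diagonal_conjTranspose, mul_assoc]
    congr 3
    ext i
    simp
  set V : Matrix ι ι ℂ := (hA.eigenvectorUnitary : Matrix ι ι ℂ) with hV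
  have hVV : star V * V = 1 := Unitary.coe_star_mul_self _
  have hVV' : V * star V = 1 := Unitary.coe_mul_star_self _
  have h1 : (star U * V) * diagonal (fun i => (hA.eigenvalues i : ℂ)) =
      diagonal (fun i => (a i : ℂ)) * (star U * V) := by
    have h2 : V * diagonal (fun i => (hA.eigenvalues i : ℂ)) * star V =
      U * diagonal (fun i => (a i : ℂ)) * star U := by rw [← eq_eigen hA]
    calc _ = star U * (V * diagonal (fun i => (hA.eigenvalues i : ℂ)) * star V) * V := by
          simp only [mul_assoc, hVV, mul_one]
      _ = (star U * U) * diagonal (fun i => (a i : ℂ)) * (star U * V) := by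
          rw [h2]; simp only [mul_assoc]
      _ = _ := by rw [hU, one_mul]
  have h3 := intertwine_diagonal h1 f
  rw [cfc_eq_eigen hA, ← hV]
  calc _ = U * ((star U * V) * diagonal (fun i => (f (hA.eigenvalues i) : ℂ))) * star V := by
        simp only [← mul_assoc, hU', one_mul]
    _ = U * diagonal (fun i => (f (a i) : ℂ)) * star U * (V * star V) := by
        rw [h3]; simp only [mul_assoc]
    _ = _ := by rw [hVV', mul_one]

theorem continuousOn_spectrum (f : ℝ → ℝ) (A : Matrix ι ι ℂ) : ContinuousOn f (spectrum ℝ A) :=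
  (Matrix.finite_real_spectrum).continuousOn f

theorem spectrum_nonneg {A : Matrix ι ι ℂ} (hA : A.PosSemidef) {x : ℝ}
    (hx : x ∈ spectrum ℝ A) : 0 ≤ x := by
  rw [hA.1.spectrum_real_eq_range_eigenvalues] at hx
  obtain ⟨i, rfl⟩ := hx
  exact hA.eigenvalues_nonneg i

theorem spectrum_pos {A : Matrix ι ι ℂ} (hA : A.PosDef) {x : ℝ}
    (hx : x ∈ spectrum ℝ A) : 0 < x := by
  rw [hA.1.spectrum_real_eq_range_eigenvalues] at hx
  obtain ⟨i, rfl⟩ := hx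
  exact hA.eigenvalues_pos i

theorem cfc_mul' (f g : ℝ → ℝ) (A : Matrix ι ι ℂ) :
    cfc f A * cfc g A = cfc (fun x => f x * g x) A :=
  (cfc_mul f g A (continuousOn_spectrum f A) (continuousOn_spectrum g A)).symm

theorem cfc_self {A : Matrix ι ι ℂ} (hA : A.IsHermitian) : cfc (fun x : ℝ => x) A = A :=
  cfc_id' ℝ A (ha := hA.isSelfAdjoint)

theorem cfc_eq_one {A : Matrix ι ι ℂ} (hA : A.IsHermitian) : cfc (fun _ : ℝ => (1 : ℝ)) A = 1 :=
  cfc_const_one ℝ A (ha := hA.isSelfAdjoint)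

theorem cfc_isHermitian (f : ℝ → ℝ) (A : Matrix ι ι ℂ) : (cfc f A).IsHermitian :=
  cfc_predicate f A

theorem cfc_posSemidef {f : ℝ → ℝ} {A : Matrix ι ι ℂ} (hA : A.IsHermitian)
    (hf : ∀ x ∈ spectrum ℝ A, 0 ≤ f x) : (cfc f A).PosSemidef := by
  rw [cfc_eq_eigen hA]
  refine PosSemidef.mul_mul_conjTranspose_same (PosSemidef.diagonal fun i => ?_) _
  exact Complex.zero_le_real.2 (hf _ (hA.eigenvalues_mem_spectrum_real i))

theorem cfc_posDef {f : ℝ → ℝ} {A : Matrix ι ι ℂ} (hA : A.IsHermitian)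
    (hf : ∀ x ∈ spectrum ℝ A, 0 < f x) : (cfc f A).PosDef := by
  refine (PosSemidef.posDef_iff_isUnit (cfc_posSemidef hA fun x hx => (hf x hx).le)).2 ?_
  refine IsUnit.of_mul_eq_one (cfc (fun x => (f x)⁻¹) A) ?_
  rw [cfc_mul', ← cfc_eq_one hA]
  exact cfc_congr fun x hx => mul_inv_cancel₀ (hf x hx).ne'

/-! ### Trace pairings -/

/-- The trace pairing of functions of two Hermitian matrices is a pairing of the functions on the
spectra against a nonnegative weight. -/
theorem exists_weight {Y X : Matrix ι ι ℂ} (hY : Y.IsHermitian) (hX : X.IsHermitian) :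
    ∃ p : ι → ι → ℝ, (∀ i j, 0 ≤ p i j) ∧ ∀ f g : ℝ → ℝ,
      rtr (cfc f Y * cfc g X) =
        ∑ i, ∑ j, p i j * (f (hY.eigenvalues i) * g (hX.eigenvalues j)) := by
  set V : Matrix ι ι ℂ := (hY.eigenvectorUnitary : Matrix ι ι ℂ) with hV
  set U : Matrix ι ι ℂ := (hX.eigenvectorUnitary : Matrix ι ι ℂ) with hU
  refine ⟨fun i j => Complex.normSq ((star V * U) i j), fun i j => Complex.normSq_nonneg _,
    fun f g => ?_⟩
  rw [cfc_eq_eigen hY, cfc_eq_eigen hX, ← hV, ← hU]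
  have h1 : trace (V * diagonal (fun i => (f (hY.eigenvalues i) : ℂ)) * star V *
      (U * diagonal (fun i => (g (hX.eigenvalues i) : ℂ)) * star U)) =
      trace (diagonal (fun i => (f (hY.eigenvalues i) : ℂ)) * (star V * U) *
        (diagonal (fun i => (g (hX.eigenvalues i) : ℂ)) * star (star V * U))) := by
    rw [star_mul, star_star]
    simp only [mul_assoc]
    rw [trace_mul_comm]
    simp only [mul_assoc]
  rw [rtr, h1, trace, Complex.re_sum]
  refine Finset.sum_congr rfl fun i _ => ?_
  rw [diag_apply, Matrix.mul_apply, Complex.re_sum]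
  refine Finset.sum_congr rfl fun j _ => ?_
  rw [diagonal_mul, diagonal_mul, star_apply]
  have : ∀ (a b : ℝ) (c : ℂ), ((a : ℂ) * c * ((b : ℂ) * star c)).re =
      Complex.normSq c * (a * b) := by
    intro a b c
    have : (a : ℂ) * c * ((b : ℂ) * star c) = ((a * b * Complex.normSq c : ℝ) : ℂ) := by
      push_cast
      rw [← Complex.mul_conj]
      simp only [Complex.star_def]
      ring
    rw [this, Complex.ofReal_re]
    ring
  exact this _ _ _

/-- Klein's inequality. -/
theorem klein {f f' : ℝ → ℝ} {X Y : Matrix ι ι ℂ} (hX : X.IsHermitian) (hY : Y.IsHermitian)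
    (h : ∀ x ∈ spectrum ℝ X, ∀ y ∈ spectrum ℝ Y, f y + f' y * (x - y) ≤ f x) :
    rtr (cfc f Y) + rtr (cfc f' Y * (X - Y)) ≤ rtr (cfc f X) := by
  obtain ⟨p, hp, hpe⟩ := exists_weight hY hX
  have e1 : rtr (cfc f Y) = rtr (cfc f Y * cfc (fun _ : ℝ => (1 : ℝ)) X) := by
    rw [cfc_eq_one hX, mul_one]
  have e2 : rtr (cfc f X) = rtr (cfc (fun _ : ℝ => (1 : ℝ)) Y * cfc f X) := by
    rw [cfc_eq_one hY, one_mul]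
  have e3 : rtr (cfc f' Y * X) = rtr (cfc f' Y * cfc (fun x : ℝ => x) X) := by
    rw [cfc_self hX]
  have e4 : rtr (cfc f' Y * Y) = rtr (cfc (fun x : ℝ => f' x * x) Y * cfc (fun _ : ℝ => (1 : ℝ)) X) := by
    rw [cfc_eq_one hX, mul_one, ← cfc_mul', cfc_self hY]
  rw [mul_sub, rtr_sub, e3, e4, e1, e2, hpe, hpe, hpe, hpe, ← Finset.sum_sub_distrib,
    ← Finset.sum_add_distrib]
  refine Finset.sum_le_sum fun i _ => ?_
  rw [← Finset.sum_sub_distrib, ← Finset.sum_add_distrib]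
  refine Finset.sum_le_sum fun j _ => ?_
  have := mul_le_mul_of_nonneg_left (h _ (hX.eigenvalues_mem_spectrum_real j) _
    (hY.eigenvalues_mem_spectrum_real i)) (hp i j)
  linarith

theorem rtr_mul_nonneg {A B : Matrix ι ι ℂ} (hA : A.PosSemidef) (hB : B.PosSemidef) :
    0 ≤ rtr (A * B) := by
  obtain ⟨p, hp, hpe⟩ := exists_weight hA.1 hB.1
  have := hpe (fun x => x) (fun x => x)
  rw [cfc_self hA.1, cfc_self hB.1] at this
  rw [this]
  exact Finset.sum_nonneg fun i _ => Finset.sum_nonneg fun j _ =>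
    mul_nonneg (hp i j) (mul_nonneg (hA.eigenvalues_nonneg i) (hB.eigenvalues_nonneg j))

/-! ### Continuity -/

theorem tendsto_cfc {κ : Type*} {l : Filter κ} {M : κ → Matrix ι ι ℂ} {M₀ : Matrix ι ι ℂ}
    {f : ℝ → ℝ} (hf : Continuous f) (hM : ∀ k, (M k).IsHermitian) (hM₀ : M₀.IsHermitian)
    (h : Tendsto M l (𝓝 M₀)) : Tendsto (fun k => cfc f (M k)) l (𝓝 (cfc f M₀)) := by
  have hc : ContinuousOn (fun A : Matrix ι ι ℂ => cfc f A) {A | A.IsHermitian} :=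
    ContinuousOn.cfc_of_mem_nhdsSet (s := univ) f univ_mem continuousOn_id
      (fun A hA => hA) hf.continuousOn
  exact (hc M₀ hM₀).tendsto.comp (tendsto_nhdsWithin_iff.2 ⟨h, Eventually.of_forall hM⟩)

theorem continuousOn_cfc_posDef {f : ℝ → ℝ} (hf : ContinuousOn f (Ioi 0)) :
    ContinuousOn (fun A : Matrix ι ι ℂ => cfc f A) {A | A.PosDef} :=
  ContinuousOn.cfc_of_mem_nhdsSet (s := Ioi 0) f
    (isOpen_Ioi.mem_nhdsSet.2 <| iUnion₂_subset fun _ hA _ hx => spectrum_pos hA hx)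
    continuousOn_id (fun _ hA => hA.1) hf

end General

section Powers

variable {ι : Type*} [Fintype ι] [DecidableEq ι]

/-! ### Generalized powers -/

theorem mpow_eq_cfc {A : Matrix ι ι ℂ} (hA : A.PosSemidef) (w : ℝ) :
    mpow A (w : ℂ) = cfc (fun x : ℝ => if x = 0 then 0 else x ^ w) A := by
  rw [mpow, dif_pos hA.1, cfc_eq_eigen hA.1]
  congr 3
  ext i
  split_ifs with h
  · simp
  · rw [Complex.ofReal_cpow (hA.eigenvalues_nonneg i)]

theorem mpow_eq_cfc_rpow {A : Matrix ι ι ℂ} (hA : A.PosSemidef) {w : ℝ} (hw : 0 < w) :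
    mpow A (w : ℂ) = cfc (fun x : ℝ => x ^ w) A := by
  rw [mpow_eq_cfc hA]
  refine cfc_congr fun x _ => ?_
  split_ifs with h
  · rw [h, Real.zero_rpow hw.ne']
  · rfl

theorem mpow_one {A : Matrix ι ι ℂ} (hA : A.PosSemidef) : mpow A ((1 : ℝ) : ℂ) = A := by
  rw [mpow_eq_cfc_rpow hA one_pos]
  simpa using cfc_self hA.1

theorem mpow_neg_one {A : Matrix ι ι ℂ} (hA : A.PosSemidef) :
    mpow A ((-1 : ℝ) : ℂ) = cfc (fun x : ℝ => x⁻¹) A := by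
  rw [mpow_eq_cfc hA]
  refine cfc_congr fun x _ => ?_
  split_ifs with h
  · simp [h]
  · rw [Real.rpow_neg_one]

end Powers

section Tensor

variable {a b : ℕ}

/-! ### Tensor products -/

theorem dtens_eq_submatrix (A : Matrix (Fin a) (Fin a) ℂ) (B : Matrix (Fin b) (Fin b) ℂ) :
    dtens A B =
      (kroneckerMap (· * ·) A B).submatrix finProdFinEquiv.symm finProdFinEquiv.symm := rfl

theorem dtens_mul (A C : Matrix (Fin a) (Fin a) ℂ) (B D : Matrix (Fin b) (Fin b) ℂ) :
    dtens A B * dtens C D = dtens (A * C) (B * D) := by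
  rw [dtens_eq_submatrix, dtens_eq_submatrix, dtens_eq_submatrix, submatrix_mul_equiv,
    mul_kronecker_mul]

theorem dtens_star (A : Matrix (Fin a) (Fin a) ℂ) (B : Matrix (Fin b) (Fin b) ℂ) :
    star (dtens A B) = dtens (star A) (star B) := by
  ext i j
  simp [dtens, star_apply]

theorem dtens_diagonal (u : Fin a → ℂ) (v : Fin b → ℂ) :
    dtens (Matrix.diagonal u) (Matrix.diagonal v) = Matrix.diagonal (fun i =>
      u (finProdFinEquiv.symm i).1 * v (finProdFinEquiv.symm i).2) := by
  rw [dtens_eq_submatrix, diagonal_kronecker_diagonal, submatrix_diagonal_equiv]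
  rfl

theorem dtens_one : dtens (1 : Matrix (Fin a) (Fin a) ℂ) (1 : Matrix (Fin b) (Fin b) ℂ) = 1 := by
  rw [dtens_eq_submatrix, one_kronecker_one, submatrix_one_equiv]

theorem trace_dtens (A : Matrix (Fin a) (Fin a) ℂ) (B : Matrix (Fin b) (Fin b) ℂ) :
    (dtens A B).trace = A.trace * B.trace := by
  rw [← trace_kronecker]
  exact Fintype.sum_equiv finProdFinEquiv.symm _ _ fun i => rfl

theorem rtr_dtens {A : Matrix (Fin a) (Fin a) ℂ} {B : Matrix (Fin b) (Fin b) ℂ}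
    (hA : A.PosSemidef) (hB : B.PosSemidef) : rtr (dtens A B) = rtr A * rtr B := by
  rw [rtr, trace_dtens, trace_eq_rtr hA, trace_eq_rtr hB, ← Complex.ofReal_mul, Complex.ofReal_re]

theorem posSemidef_dtens {A : Matrix (Fin a) (Fin a) ℂ} {B : Matrix (Fin b) (Fin b) ℂ}
    (hA : A.PosSemidef) (hB : B.PosSemidef) : (dtens A B).PosSemidef :=
  (hA.kronecker hB).submatrix _

theorem posDef_dtens {A : Matrix (Fin a) (Fin a) ℂ} {B : Matrix (Fin b) (Fin b) ℂ}
    (hA : A.PosDef) (hB : B.PosDef) : (dtens A B).PosDef := by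
  refine (PosSemidef.posDef_iff_isUnit (posSemidef_dtens hA.posSemidef hB.posSemidef)).2 ?_
  refine IsUnit.of_mul_eq_one (dtens A⁻¹ B⁻¹) ?_
  rw [dtens_mul, mul_nonsing_inv _ ((isUnit_iff_isUnit_det _).1 hA.isUnit),
    mul_nonsing_inv _ ((isUnit_iff_isUnit_det _).1 hB.isUnit), dtens_one]

theorem continuous_dtens : Continuous
    (fun p : Matrix (Fin a) (Fin a) ℂ × Matrix (Fin b) (Fin b) ℂ => dtens p.1 p.2) := by
  refine continuous_matrix fun i j => ?_
  simp only [dtens, of_apply]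
  exact (continuous_fst.matrix_elem _ _).mul (continuous_snd.matrix_elem _ _)

theorem cfc_dtens {A : Matrix (Fin a) (Fin a) ℂ} {B : Matrix (Fin b) (Fin b) ℂ}
    (hA : A.PosSemidef) (hB : B.PosSemidef) {h : ℝ → ℝ}
    (hh : ∀ x y, 0 ≤ x → 0 ≤ y → h (x * y) = h x * h y) :
    cfc h (dtens A B) = dtens (cfc h A) (cfc h B) := by
  set U : Matrix (Fin a) (Fin a) ℂ := (hA.1.eigenvectorUnitary : Matrix (Fin a) (Fin a) ℂ) with hU
  set V : Matrix (Fin b) (Fin b) ℂ := (hB.1.eigenvectorUnitary : Matrix (Fin b) (Fin b) ℂ) with hV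
  have hUU : star U * U = 1 := Unitary.coe_star_mul_self _
  have hVV : star V * V = 1 := Unitary.coe_star_mul_self _
  have key : ∀ f : ℝ → ℝ, (∀ x y, 0 ≤ x → 0 ≤ y → f (x * y) = f x * f y) →
      dtens (cfc f A) (cfc f B) = dtens U V * Matrix.diagonal (fun i =>
        ((f (hA.1.eigenvalues (finProdFinEquiv.symm i).1 *
          hB.1.eigenvalues (finProdFinEquiv.symm i).2) : ℝ) : ℂ)) * star (dtens U V) := by
    intro f hf
    rw [cfc_eq_eigen hA.1, cfc_eq_eigen hB.1, ← hU, ← hV, ← dtens_mul, ← dtens_mul, dtens_star,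
      dtens_diagonal]
    congr 3
    ext i
    rw [hf _ _ (hA.eigenvalues_nonneg _) (hB.eigenvalues_nonneg _), Complex.ofReal_mul]
  have h1 := key (fun x => x) fun _ _ _ _ => rfl
  rw [cfc_self hA.1, cfc_self hB.1] at h1
  rw [h1, cfc_unitary_conj_diagonal (by rw [dtens_star, dtens_mul, hUU, hVV, dtens_one]), key h hh]

theorem cfc_rpow_dtens {A : Matrix (Fin a) (Fin a) ℂ} {B : Matrix (Fin b) (Fin b) ℂ}
    (hA : A.PosSemidef) (hB : B.PosSemidef) (w : ℝ) :
    cfc (fun x : ℝ => x ^ w) (dtens A B) =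
      dtens (cfc (fun x : ℝ => x ^ w) A) (cfc (fun x : ℝ => x ^ w) B) :=
  cfc_dtens hA hB fun _ _ hx hy => Real.mul_rpow hx hy

theorem cfc_inv_dtens {A : Matrix (Fin a) (Fin a) ℂ} {B : Matrix (Fin b) (Fin b) ℂ}
    (hA : A.PosSemidef) (hB : B.PosSemidef) :
    cfc (fun x : ℝ => x⁻¹) (dtens A B) =
      dtens (cfc (fun x : ℝ => x⁻¹) A) (cfc (fun x : ℝ => x⁻¹) B) :=
  cfc_dtens hA hB fun _ _ _ _ => mul_inv _ _

theorem smul_dtens_smul (r s : ℝ) (A : Matrix (Fin a) (Fin a) ℂ) (B : Matrix (Fin b) (Fin b) ℂ) :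
    dtens (r • A) (s • B) = (r * s) • dtens A B := by
  ext i j
  simp only [dtens, of_apply, Matrix.smul_apply, Complex.real_smul, Complex.ofReal_mul]
  ring

theorem isState_dtens {A : Matrix (Fin a) (Fin a) ℂ} {B : Matrix (Fin b) (Fin b) ℂ}
    (hA : IsState A) (hB : IsState B) : IsState (dtens A B) :=
  ⟨posSemidef_dtens hA.1 hB.1, by rw [trace_dtens, hA.2, hB.2, mul_one]⟩

theorem polar_bound_dtens {S : (d : ℕ) → Set (Matrix (Fin d) (Fin d) ℂ)} (hS : Assumption1' S)
    (ha : 1 ≤ a) (hb : 1 ≤ b) {G : Matrix (Fin a) (Fin a) ℂ} {H : Matrix (Fin b) (Fin b) ℂ}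
    (hG : G.PosSemidef) (hH : H.PosSemidef) {g h : ℝ} (hg : 0 < g) (hh : 0 < h)
    (hGg : ∀ X ∈ S a, rtr (G * X) ≤ g) (hHh : ∀ X ∈ S b, rtr (H * X) ≤ h) :
    ∀ X ∈ S (a * b), rtr (dtens G H * X) ≤ g * h := by
  have scale : ∀ {d : ℕ} {K : Matrix (Fin d) (Fin d) ℂ} {k : ℝ}, K.PosSemidef → 0 < k →
      (∀ X ∈ S d, rtr (K * X) ≤ k) → k⁻¹ • K ∈ polar (S d) := by
    intro d K k hK hk hKk
    refine ⟨hK.smul (inv_nonneg.2 hk.le), fun Y hY => ?_⟩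
    rw [smul_mul_assoc, rtr_smul, inv_mul_le_iff₀ hk, mul_one]
    exact hKk Y hY
  intro X hX
  have := (hS.polarTens a b ha hb _ (scale hG hg hGg) _ (scale hH hh hHh)).2 X hX
  rw [smul_dtens_smul, smul_mul_assoc, rtr_smul, ← mul_inv, inv_mul_le_iff₀ (mul_pos hg hh),
    mul_one] at this
  exact this

end Tensor

section Tangents

/-! ### Tangent inequalities for powers -/

theorem rpow_le_tangent {x y z : ℝ} (hx : 0 ≤ x) (hy : 0 < y) (hz0 : 0 ≤ z) (hz1 : z ≤ 1) :
    x ^ z ≤ y ^ z + z * y ^ (z - 1) * (x - y) := by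
  have h := rpow_one_add_le_one_add_mul_self (s := x / y - 1)
    (by have := div_nonneg hx hy.le; linarith) hz0 hz1
  have e1 : (1 + (x / y - 1)) ^ z = x ^ z / y ^ z := by
    rw [← Real.div_rpow hx hy.le]; congr 1; ring
  rw [e1, div_le_iff₀ (Real.rpow_pos_of_pos hy z)] at h
  refine h.trans_eq ?_
  rw [Real.rpow_sub_one hy.ne']
  field_simp

theorem tangent_le_rpow {x y z : ℝ} (hx : 0 ≤ x) (hy : 0 ≤ y) (hz : 1 ≤ z) :
    y ^ z + z * y ^ (z - 1) * (x - y) ≤ x ^ z := by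
  rcases hy.eq_or_lt with rfl | hy
  · rcases hz.eq_or_lt with rfl | hz
    · simp
    · rw [Real.zero_rpow (by linarith), Real.zero_rpow (by linarith)]
      simpa using Real.rpow_nonneg hx z
  have h := one_add_mul_self_le_rpow_one_add (s := x / y - 1)
    (by have := div_nonneg hx hy.le; linarith) hz
  have e1 : (1 + (x / y - 1)) ^ z = x ^ z / y ^ z := by
    rw [← Real.div_rpow hx hy.le]; congr 1; ring
  rw [e1, le_div_iff₀ (Real.rpow_pos_of_pos hy z)] at h
  refine Eq.trans_le ?_ h
  rw [Real.rpow_sub_one hy.ne']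
  field_simp

theorem posDef_add_smul_one {ι : Type*} [DecidableEq ι] {X : Matrix ι ι ℂ}
    (hX : X.PosSemidef) {ε : ℝ} (hε : 0 < ε) :
    (X + ε • (1 : Matrix ι ι ℂ)).PosDef :=
  PosDef.posSemidef_add hX (PosDef.one.smul hε)

end Tangents

section Functionals

variable {ι : Type*} [Fintype ι] [DecidableEq ι]

theorem rtr_cfc_rpow_le {z : ℝ} (hz0 : 0 ≤ z) (hz1 : z ≤ 1) {M N : Matrix ι ι ℂ}
    (hM : M.PosSemidef) (hN : N.PosDef) :
    rtr (cfc (fun x : ℝ => x ^ z) M) ≤ rtr (cfc (fun x : ℝ => x ^ z) N) +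
      z * rtr (cfc (fun x : ℝ => x ^ (z - 1)) N * (M - N)) := by
  have h := klein (f := fun x => -x ^ z) (f' := fun x => -z * x ^ (z - 1)) hM.1 hN.1
    (fun x hx y hy => by
      have := rpow_le_tangent (spectrum_nonneg hM hx) (spectrum_pos hN hy) hz0 hz1
      linarith)
  rw [cfc_neg, cfc_neg, cfc_const_mul _ _ _ (continuousOn_spectrum _ _), smul_mul_assoc, rtr_smul,
    rtr_neg, rtr_neg] at h
  linarith

theorem le_rtr_cfc_rpow {z : ℝ} (hz : 1 ≤ z) {M N : Matrix ι ι ℂ}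
    (hM : M.PosSemidef) (hN : N.PosSemidef) :
    rtr (cfc (fun x : ℝ => x ^ z) N) + z * rtr (cfc (fun x : ℝ => x ^ (z - 1)) N * (M - N)) ≤
      rtr (cfc (fun x : ℝ => x ^ z) M) := by
  have h := klein (f := fun x => x ^ z) (f' := fun x => z * x ^ (z - 1)) hM.1 hN.1
    (fun x hx y hy => tangent_le_rpow (spectrum_nonneg hM hx) (spectrum_nonneg hN hy) hz)
  rwa [cfc_const_mul _ _ _ (continuousOn_spectrum _ _), smul_mul_assoc, rtr_smul] at h

theorem rtr_cfc_rpow_sub_one_mul {z : ℝ} (hz : z ≠ 0) {M : Matrix ι ι ℂ} (hM : M.PosSemidef) :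
    rtr (cfc (fun x : ℝ => x ^ (z - 1)) M * M) = rtr (cfc (fun x : ℝ => x ^ z) M) := by
  have : cfc (fun x : ℝ => x ^ (z - 1)) M * M =
      cfc (fun x : ℝ => x ^ (z - 1)) M * cfc (fun x : ℝ => x) M := by rw [cfc_self hM.1]
  rw [this, cfc_mul']
  congr 1
  refine cfc_congr fun x hx => ?_
  rcases (spectrum_nonneg hM hx).eq_or_lt with rfl | h
  · simp [Real.zero_rpow hz]
  · simp only [Real.rpow_sub_one h.ne']
    field_simp

theorem continuousOn_cfc_isHermitian {f : ℝ → ℝ} (hf : Continuous f) :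
    ContinuousOn (fun A : Matrix ι ι ℂ => cfc f A) {A | A.IsHermitian} :=
  ContinuousOn.cfc_of_mem_nhdsSet (s := univ) f univ_mem continuousOn_id
    (fun _ hA => hA) hf.continuousOn

/-! ### Optimality conditions on compact convex sets -/

theorem exists_optimal {S : Set (Matrix ι ι ℂ)} (hpsd : ∀ X ∈ S, X.PosSemidef)
    (hcvx : Convex ℝ S) (hcpt : IsCompact S) (hne : S.Nonempty) {ε : ℝ} (hε : 0 < ε)
    {F : Matrix ι ι ℂ → ℝ} {G : Matrix ι ι ℂ → Matrix ι ι ℂ}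
    (hF : ContinuousOn F {X | X.PosDef}) (hG : ContinuousOn G {X | X.PosDef}) {κ : ℝ} (hκ : 0 < κ)
    (htan : ∀ X Y : Matrix ι ι ℂ, X.PosDef → Y.PosDef → F Y ≤ F X + κ * rtr (G Y * (X - Y))) :
    ∃ σ ∈ S, ∀ X ∈ S, rtr (G (σ + ε • (1 : Matrix ι ι ℂ)) * X) ≤
      rtr (G (σ + ε • (1 : Matrix ι ι ℂ)) * σ) := by
  have hcont : ContinuousOn (fun X => F (X + ε • (1 : Matrix ι ι ℂ))) S :=
    hF.comp (continuous_id.add continuous_const).continuousOn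
      fun X hX => posDef_add_smul_one (hpsd X hX) hε
  obtain ⟨σ, hσ, hmin⟩ := hcpt.exists_isMinOn hne hcont
  refine ⟨σ, hσ, fun X hX => ?_⟩
  set D := X - σ with hD
  set Y : ℝ → Matrix ι ι ℂ := fun t => (σ + t • D) + ε • (1 : Matrix ι ι ℂ) with hY
  have hmem : ∀ t ∈ Icc (0 : ℝ) 1, σ + t • D ∈ S := fun t ht =>
    hcvx.add_smul_sub_mem hσ hX ht
  have hpos : ∀ t ∈ Icc (0 : ℝ) 1, (Y t).PosDef := fun t ht =>
    posDef_add_smul_one (hpsd _ (hmem t ht)) hε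
  have hineq : ∀ t ∈ Ioc (0 : ℝ) 1, rtr (G (Y t) * D) ≤ 0 := by
    intro t ht
    have ht' : t ∈ Icc (0 : ℝ) 1 := ⟨ht.1.le, ht.2⟩
    have h1 := htan (σ + ε • (1 : Matrix ι ι ℂ)) (Y t)
      (posDef_add_smul_one (hpsd σ hσ) hε) (hpos t ht')
    have h2 : F (σ + ε • (1 : Matrix ι ι ℂ)) ≤ F (Y t) := hmin (hmem t ht')
    have h3 : (σ + ε • (1 : Matrix ι ι ℂ)) - Y t = (-t) • D := by
      rw [hY, neg_smul]; dsimp only; abel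
    rw [h3, mul_smul_comm, rtr_smul] at h1
    have h4 : 0 ≤ κ * (-t * rtr (G (Y t) * D)) := by linarith
    have h5 : 0 < κ * t := mul_pos hκ ht.1
    by_contra hcon
    push Not at hcon
    have := mul_pos h5 hcon
    linarith
  have hYc : Continuous Y := by fun_prop
  have hlim : ContinuousOn (fun t => rtr (G (Y t) * D)) (Icc 0 1) :=
    continuous_rtr.comp_continuousOn
      ((hG.comp hYc.continuousOn hpos).mul continuousOn_const)
  have h0 : Tendsto (fun t => rtr (G (Y t) * D)) (𝓝[Ioc (0 : ℝ) 1] 0) (𝓝 (rtr (G (Y 0) * D))) :=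
    (hlim 0 ⟨le_rfl, zero_le_one⟩).mono_left (nhdsWithin_mono _ Ioc_subset_Icc_self)
  have : (𝓝[Ioc (0 : ℝ) 1] 0).NeBot := by
    rw [nhdsWithin_Ioc_eq_nhdsGT zero_lt_one]; infer_instance
  have h := le_of_tendsto h0 (eventually_nhdsWithin_of_forall hineq)
  have e : Y 0 = σ + ε • (1 : Matrix ι ι ℂ) := by simp [hY]
  rw [e, hD, mul_sub, rtr_sub] at h
  linarith

theorem exists_optimal' {S : Set (Matrix ι ι ℂ)} (hpsd : ∀ X ∈ S, X.PosSemidef)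
    (hcvx : Convex ℝ S) (hcpt : IsCompact S) (hne : S.Nonempty) {ε : ℝ} (hε : 0 < ε)
    {F : Matrix ι ι ℂ → ℝ} {G : Matrix ι ι ℂ → Matrix ι ι ℂ}
    (hF : ContinuousOn F {X | X.PosDef}) (hG : ContinuousOn G {X | X.PosDef}) {κ : ℝ} (hκ : 0 < κ)
    (htan : ∀ X Y : Matrix ι ι ℂ, X.PosDef → Y.PosDef → F Y ≤ F X + κ * rtr (G Y * (X - Y)))
    (hGpsd : ∀ X : Matrix ι ι ℂ, X.PosDef → (G X).PosSemidef) :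
    ∃ σ ∈ S, ∀ X ∈ S, rtr (G (σ + ε • (1 : Matrix ι ι ℂ)) * X) ≤
      rtr (G (σ + ε • (1 : Matrix ι ι ℂ)) * (σ + ε • (1 : Matrix ι ι ℂ))) := by
  obtain ⟨σ, hσ, h⟩ := exists_optimal hpsd hcvx hcpt hne hε hF hG hκ htan
  refine ⟨σ, hσ, fun X hX => (h X hX).trans ?_⟩
  rw [mul_add, rtr_add, mul_smul_comm, mul_one, rtr_smul]
  have := mul_nonneg hε.le (rtr_nonneg (hGpsd _ (posDef_add_smul_one (hpsd σ hσ) hε)))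
  linarith

end Functionals

section Sandwich

variable {ι : Type*} [Fintype ι]

theorem posSemidef_sandwich {A X : Matrix ι ι ℂ} (hA : A.IsHermitian) (hX : X.PosSemidef) :
    (A * X * A).PosSemidef := by
  have := hX.mul_mul_conjTranspose_same A
  rwa [hA.eq] at this

theorem posDef_sandwich [DecidableEq ι] {A X : Matrix ι ι ℂ} (hA : A.PosDef) (hX : X.PosDef) :
    (A * X * A).PosDef :=
  (PosSemidef.posDef_iff_isUnit (posSemidef_sandwich hA.1 hX.posSemidef)).2
    ((hA.isUnit.mul hX.isUnit).mul hA.isUnit)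

theorem rtr_sandwich_mul (A C X : Matrix ι ι ℂ) : rtr (A * C * A * X) = rtr (C * (A * X * A)) := by
  rw [mul_assoc, mul_assoc, rtr_mul_comm]
  simp only [mul_assoc]

theorem rtr_pos [Nonempty ι] {A : Matrix ι ι ℂ} (hA : A.PosDef) : 0 < rtr A :=
  (Complex.lt_def.1 hA.trace_pos).1

theorem continuous_sandwich (A : Matrix ι ι ℂ) :
    Continuous (fun Y : Matrix ι ι ℂ => A * Y * A) :=
  (continuous_const.mul continuous_id).mul continuous_const

end Sandwich

theorem tendsto_add_smul_one {ι κ : Type*} [DecidableEq ι] {l : Filter κ} {ε : κ → ℝ}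
    (hε : Tendsto ε l (𝓝 0))
    {Y : κ → Matrix ι ι ℂ} {Y₀ : Matrix ι ι ℂ} (hY : Tendsto Y l (𝓝 Y₀)) :
    Tendsto (fun n => Y n + ε n • (1 : Matrix ι ι ℂ)) l (𝓝 Y₀) := by
  simpa using hY.add (hε.smul_const (1 : Matrix ι ι ℂ))

section Concave

variable {ι : Type*} [Fintype ι] [DecidableEq ι]

/-! ### The concave functional `Y ↦ Tr (A Y A)^z`, `0 < z < 1` -/

/-- The functional `Y ↦ Tr (A Y A)^z`. -/
def sandTr (z : ℝ) (A Y : Matrix ι ι ℂ) : ℝ := rtr (cfc (fun x : ℝ => x ^ z) (A * Y * A))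

/-- The gradient of `sandTr z A`, up to the factor `z`. -/
def sandGrad (z : ℝ) (A Y : Matrix ι ι ℂ) : Matrix ι ι ℂ :=
  A * cfc (fun x : ℝ => x ^ (z - 1)) (A * Y * A) * A

theorem rtr_sandGrad_self {z : ℝ} (hz : z ≠ 0) {A Y : Matrix ι ι ℂ} (hA : A.IsHermitian)
    (hY : Y.PosSemidef) : rtr (sandGrad z A Y * Y) = sandTr z A Y := by
  rw [sandGrad, rtr_sandwich_mul, rtr_cfc_rpow_sub_one_mul hz (posSemidef_sandwich hA hY), sandTr]

theorem posSemidef_sandGrad (z : ℝ) {A Y : Matrix ι ι ℂ} (hA : A.IsHermitian)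
    (hY : Y.PosSemidef) : (sandGrad z A Y).PosSemidef :=
  posSemidef_sandwich hA (cfc_posSemidef (posSemidef_sandwich hA hY).1 fun _ hx =>
    Real.rpow_nonneg (spectrum_nonneg (posSemidef_sandwich hA hY) hx) _)

theorem sandTr_nonneg (z : ℝ) {A Y : Matrix ι ι ℂ} (hA : A.IsHermitian)
    (hY : Y.PosSemidef) : 0 ≤ sandTr z A Y :=
  rtr_nonneg (cfc_posSemidef (posSemidef_sandwich hA hY).1 fun _ hx =>
    Real.rpow_nonneg (spectrum_nonneg (posSemidef_sandwich hA hY) hx) _)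

theorem sandTr_pos [Nonempty ι] (z : ℝ) {A Y : Matrix ι ι ℂ} (hA : A.PosDef)
    (hY : Y.PosDef) : 0 < sandTr z A Y :=
  rtr_pos (cfc_posDef (posDef_sandwich hA hY).1 fun _ hx =>
    Real.rpow_pos_of_pos (spectrum_pos (posDef_sandwich hA hY) hx) _)

theorem sandTr_le_tangent {z : ℝ} (hz0 : 0 ≤ z) (hz1 : z ≤ 1) {A X Y : Matrix ι ι ℂ}
    (hA : A.PosDef) (hX : X.PosSemidef) (hY : Y.PosDef) :
    sandTr z A X ≤ sandTr z A Y + z * rtr (sandGrad z A Y * (X - Y)) := by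
  have := rtr_cfc_rpow_le hz0 hz1 (posSemidef_sandwich hA.1 hX) (posDef_sandwich hA hY)
  rw [sandGrad, rtr_sandwich_mul, mul_sub, sub_mul]
  exact this

theorem continuousOn_rpow_Ioi (w : ℝ) : ContinuousOn (fun x : ℝ => x ^ w) (Ioi 0) :=
  fun x hx => (Real.continuousAt_rpow_const x w (Or.inl (ne_of_gt hx))).continuousWithinAt

theorem continuousOn_sandTr (z : ℝ) {A : Matrix ι ι ℂ} (hA : A.PosDef) :
    ContinuousOn (sandTr z A) {Y | Y.PosDef} :=
  continuous_rtr.comp_continuousOn ((continuousOn_cfc_posDef (continuousOn_rpow_Ioi z)).comp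
    (continuous_sandwich A).continuousOn fun _ hY => posDef_sandwich hA hY)

theorem continuousOn_sandGrad (z : ℝ) {A : Matrix ι ι ℂ} (hA : A.PosDef) :
    ContinuousOn (sandGrad z A) {Y | Y.PosDef} :=
  (continuous_sandwich A).comp_continuousOn
    ((continuousOn_cfc_posDef (continuousOn_rpow_Ioi (z - 1))).comp
      (continuous_sandwich A).continuousOn fun _ hY => posDef_sandwich hA hY)

theorem tendsto_sandTr {z : ℝ} (hz : 0 ≤ z) {κ : Type*} {l : Filter κ} {A Y : κ → Matrix ι ι ℂ}
    {A₀ Y₀ : Matrix ι ι ℂ} (hA : ∀ k, (A k).IsHermitian) (hA₀ : A₀.IsHermitian)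
    (hY : ∀ k, (Y k).PosSemidef) (hY₀ : Y₀.PosSemidef) (hAl : Tendsto A l (𝓝 A₀))
    (hYl : Tendsto Y l (𝓝 Y₀)) :
    Tendsto (fun k => sandTr z (A k) (Y k)) l (𝓝 (sandTr z A₀ Y₀)) :=
  (continuous_rtr.tendsto _).comp (tendsto_cfc (Real.continuous_rpow_const hz)
    (fun k => (posSemidef_sandwich (hA k) (hY k)).1) (posSemidef_sandwich hA₀ hY₀).1
    ((hAl.mul hYl).mul hAl))

theorem sandTr_dtens {a b : ℕ} (z : ℝ) {A Y : Matrix (Fin a) (Fin a) ℂ}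
    {B W : Matrix (Fin b) (Fin b) ℂ} (hA : A.IsHermitian) (hB : B.IsHermitian)
    (hY : Y.PosSemidef) (hW : W.PosSemidef) :
    sandTr z (dtens A B) (dtens Y W) = sandTr z A Y * sandTr z B W := by
  have h1 := posSemidef_sandwich hA hY
  have h2 := posSemidef_sandwich hB hW
  rw [sandTr, dtens_mul, dtens_mul, cfc_rpow_dtens h1 h2, rtr_dtens]
  · rfl
  · exact cfc_posSemidef h1.1 fun _ hx => Real.rpow_nonneg (spectrum_nonneg h1 hx) _
  · exact cfc_posSemidef h2.1 fun _ hx => Real.rpow_nonneg (spectrum_nonneg h2 hx) _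

theorem sandGrad_dtens {a b : ℕ} (z : ℝ) {A Y : Matrix (Fin a) (Fin a) ℂ}
    {B W : Matrix (Fin b) (Fin b) ℂ} (hA : A.IsHermitian) (hB : B.IsHermitian)
    (hY : Y.PosSemidef) (hW : W.PosSemidef) :
    sandGrad z (dtens A B) (dtens Y W) = dtens (sandGrad z A Y) (sandGrad z B W) := by
  rw [sandGrad, dtens_mul, dtens_mul,
    cfc_rpow_dtens (posSemidef_sandwich hA hY) (posSemidef_sandwich hB hW), dtens_mul, dtens_mul]
  rfl

theorem exists_sandTr_optimal {z : ℝ} (hz0 : 0 < z) (hz1 : z ≤ 1) {A : Matrix ι ι ℂ}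
    (hA : A.PosDef) {S : Set (Matrix ι ι ℂ)} (hpsd : ∀ X ∈ S, X.PosSemidef)
    (hcvx : Convex ℝ S) (hcpt : IsCompact S) (hne : S.Nonempty) {ε : ℝ} (hε : 0 < ε) :
    ∃ σ ∈ S, ∀ X ∈ S, rtr (sandGrad z A (σ + ε • (1 : Matrix ι ι ℂ)) * X) ≤
      sandTr z A (σ + ε • (1 : Matrix ι ι ℂ)) := by
  obtain ⟨σ, hσ, h⟩ := exists_optimal' hpsd hcvx hcpt hne hε
    (continuousOn_sandTr z hA).neg (continuousOn_sandGrad z hA) hz0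
    (fun X Y hX hY => by
      have := sandTr_le_tangent hz0.le hz1 hA hX.posSemidef hY
      simp only [Pi.neg_apply]
      linarith)
    (fun X hX => posSemidef_sandGrad z hA.1 hX.posSemidef)
  refine ⟨σ, hσ, fun X hX => (h X hX).trans_eq ?_⟩
  exact rtr_sandGrad_self hz0.ne' hA.1 (posDef_add_smul_one (hpsd σ hσ) hε).posSemidef

theorem sandTr_bound_of_posDef {a b : ℕ} (ha : 1 ≤ a) (hb : 1 ≤ b) {z : ℝ} (hz0 : 0 < z)
    (hz1 : z ≤ 1) {A : Matrix (Fin a) (Fin a) ℂ} {B : Matrix (Fin b) (Fin b) ℂ}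
    (hA : A.PosDef) (hB : B.PosDef) {S : (d : ℕ) → Set (Matrix (Fin d) (Fin d) ℂ)}
    (hS : Assumption1' S) (hSa : (S a).Nonempty) (hSb : (S b).Nonempty) {ε : ℝ} (hε : 0 < ε) :
    ∃ σ ∈ S a, ∃ τ ∈ S b, ∀ X ∈ S (a * b), sandTr z (dtens A B) X ≤
      sandTr z A (σ + ε • (1 : Matrix _ _ ℂ)) * sandTr z B (τ + ε • (1 : Matrix _ _ ℂ)) := by
  have : Nonempty (Fin a) := ⟨⟨0, ha⟩⟩
  have : Nonempty (Fin b) := ⟨⟨0, hb⟩⟩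
  have hab : 1 ≤ a * b := Nat.mul_pos ha hb
  obtain ⟨σ, hσ, h1⟩ := exists_sandTr_optimal hz0 hz1 hA (hS.psd a ha) (hS.convex a ha)
    (hS.compact a ha) hSa hε
  obtain ⟨τ, hτ, h2⟩ := exists_sandTr_optimal hz0 hz1 hB (hS.psd b hb) (hS.convex b hb)
    (hS.compact b hb) hSb hε
  refine ⟨σ, hσ, τ, hτ, fun X hX => ?_⟩
  have pσ := posDef_add_smul_one (hS.psd a ha σ hσ) hε
  have pτ := posDef_add_smul_one (hS.psd b hb τ hτ) hε
  set σ' := σ + ε • (1 : Matrix _ _ ℂ)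
  set τ' := τ + ε • (1 : Matrix _ _ ℂ)
  have h3 := polar_bound_dtens hS ha hb (posSemidef_sandGrad z hA.1 pσ.posSemidef)
    (posSemidef_sandGrad z hB.1 pτ.posSemidef) (sandTr_pos z hA pσ) (sandTr_pos z hB pτ) h1 h2 X hX
  have pAB := posDef_dtens hA hB
  have h4 := sandTr_le_tangent hz0.le hz1 pAB (hS.psd _ hab X hX) (posDef_dtens pσ pτ)
  rw [mul_sub, rtr_sub, rtr_sandGrad_self hz0.ne' pAB.1 (posDef_dtens pσ pτ).posSemidef,
    sandGrad_dtens z hA.1 hB.1 pσ.posSemidef pτ.posSemidef,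
    sandTr_dtens z hA.1 hB.1 pσ.posSemidef pτ.posSemidef] at h4
  nlinarith [mul_le_mul_of_nonneg_left h3 hz0.le]

theorem tendsto_dtens {a b : ℕ} {κ : Type*} {l : Filter κ} {A : κ → Matrix (Fin a) (Fin a) ℂ}
    {B : κ → Matrix (Fin b) (Fin b) ℂ} {A₀ : Matrix (Fin a) (Fin a) ℂ}
    {B₀ : Matrix (Fin b) (Fin b) ℂ} (hA : Tendsto A l (𝓝 A₀)) (hB : Tendsto B l (𝓝 B₀)) :
    Tendsto (fun k => dtens (A k) (B k)) l (𝓝 (dtens A₀ B₀)) :=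
  (continuous_dtens.tendsto (A₀, B₀)).comp (hA.prodMk_nhds hB)

theorem sandTr_bound {a b : ℕ} (ha : 1 ≤ a) (hb : 1 ≤ b) {z : ℝ} (hz0 : 0 < z)
    (hz1 : z ≤ 1) {A : Matrix (Fin a) (Fin a) ℂ} {B : Matrix (Fin b) (Fin b) ℂ}
    (hA : A.PosSemidef) (hB : B.PosSemidef) {S : (d : ℕ) → Set (Matrix (Fin d) (Fin d) ℂ)}
    (hS : Assumption1' S) (hSa : (S a).Nonempty) (hSb : (S b).Nonempty) :
    ∃ σ ∈ S a, ∃ τ ∈ S b, ∀ X ∈ S (a * b), sandTr z (dtens A B) X ≤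
      sandTr z A σ * sandTr z B τ := by
  have hab : 1 ≤ a * b := Nat.mul_pos ha hb
  set ε : ℕ → ℝ := fun n => 1 / ((n : ℝ) + 1) with hεdef
  have hε : ∀ n, 0 < ε n := fun n => Nat.one_div_pos_of_nat
  have hεl : Tendsto ε atTop (𝓝 0) := tendsto_one_div_add_atTop_nhds_zero_nat
  have pA := fun n => posDef_add_smul_one hA (hε n)
  have pB := fun n => posDef_add_smul_one hB (hε n)
  choose σ hσ τ hτ h using fun n => sandTr_bound_of_posDef ha hb hz0 hz1 (pA n) (pB n) hS hSa hSb
    (hε n)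
  obtain ⟨⟨σ₀, τ₀⟩, ⟨hσ₀, hτ₀⟩, φ, hφ, hlim⟩ :=
    ((hS.compact a ha).prod (hS.compact b hb)).tendsto_subseq
      (x := fun n => (σ n, τ n)) fun n => ⟨hσ n, hτ n⟩
  have hεφ : Tendsto (fun n => ε (φ n)) atTop (𝓝 0) := hεl.comp hφ.tendsto_atTop
  have lA := tendsto_add_smul_one hεφ (tendsto_const_nhds (x := A))
  have lB := tendsto_add_smul_one hεφ (tendsto_const_nhds (x := B))
  have lσ := tendsto_add_smul_one hεφ (Y := fun n => σ (φ n)) hlim.fst_nhds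
  have lτ := tendsto_add_smul_one hεφ (Y := fun n => τ (φ n)) hlim.snd_nhds
  refine ⟨σ₀, hσ₀, τ₀, hτ₀, fun X hX => ?_⟩
  have pX := hS.psd _ hab X hX
  have l0 := tendsto_dtens lA lB
  have l1 := tendsto_sandTr hz0.le (fun n => (posDef_dtens (pA (φ n)) (pB (φ n))).1)
    (posSemidef_dtens hA hB).1 (fun _ => pX) pX l0 tendsto_const_nhds
  have l2 := tendsto_sandTr hz0.le (fun n => (pA (φ n)).1) hA.1
    (fun n => (posDef_add_smul_one (hS.psd a ha _ (hσ (φ n))) (hε (φ n))).posSemidef)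
    (hS.psd a ha _ hσ₀) lA lσ
  have l3 := tendsto_sandTr hz0.le (fun n => (pB (φ n)).1) hB.1
    (fun n => (posDef_add_smul_one (hS.psd b hb _ (hτ (φ n))) (hε (φ n))).posSemidef)
    (hS.psd b hb _ hτ₀) lB lτ
  exact le_of_tendsto_of_tendsto' l1 (l2.mul l3) fun n => h (φ n) X hX

end Concave

section Support

variable {ι : Type*} [Fintype ι] [DecidableEq ι]

/-! ### Supports -/

theorem mul_eq_zero_of_sandwich_eq_zero {A Y : Matrix ι ι ℂ} (hA : A.IsHermitian)
    (hY : Y.PosSemidef) (h : A * Y * A = 0) : Y * A = 0 := by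
  obtain ⟨B, hB, rfl⟩ : ∃ B : Matrix ι ι ℂ, B.IsHermitian ∧ B * B = Y := by
    refine ⟨cfc Real.sqrt Y, cfc_isHermitian _ _, ?_⟩
    rw [cfc_mul']
    conv_rhs => rw [← cfc_self hY.1]
    exact cfc_congr fun x hx => Real.mul_self_sqrt (spectrum_nonneg hY hx)
  have hBA : (B * A)ᴴ * (B * A) = 0 := by
    rw [conjTranspose_mul, hA.eq, hB.eq, ← h]
    simp only [mul_assoc]
  rw [mul_assoc, conjTranspose_mul_self_eq_zero.1 hBA, mul_zero]

theorem cfc_rpow_mul_cfc_rpow {M : Matrix ι ι ℂ} (hM : M.PosSemidef) {p : ℝ} (hp : p ≠ 0) :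
    cfc (fun x : ℝ => x ^ p) M * cfc (fun x : ℝ => x ^ (1 - p)) M = M := by
  rw [cfc_mul']
  conv_rhs => rw [← cfc_self hM.1]
  refine cfc_congr fun x hx => ?_
  rcases (spectrum_nonneg hM hx).eq_or_lt with rfl | h
  · simp [Real.zero_rpow hp]
  · simp only [← Real.rpow_add h]
    simp

theorem mul_cfc_rpow_sub_one {M : Matrix ι ι ℂ} (hM : M.PosSemidef) {p : ℝ} (hp : p ≠ 0) :
    M * cfc (fun x : ℝ => x ^ (p - 1)) M = cfc (fun x : ℝ => x ^ p) M := by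
  have : M * cfc (fun x : ℝ => x ^ (p - 1)) M =
      cfc (fun x : ℝ => x) M * cfc (fun x : ℝ => x ^ (p - 1)) M := by rw [cfc_self hM.1]
  rw [this, cfc_mul']
  refine cfc_congr fun x hx => ?_
  rcases (spectrum_nonneg hM hx).eq_or_lt with rfl | h
  · simp [Real.zero_rpow hp]
  · simp only [Real.rpow_sub_one h.ne']
    field_simp

theorem mul_cfc_rpow_eq_zero_iff {M : Matrix ι ι ℂ} (hM : M.PosSemidef) {p : ℝ} (hp : p ≠ 0)
    (N : Matrix ι ι ℂ) : N * cfc (fun x : ℝ => x ^ p) M = 0 ↔ N * M = 0 := by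
  constructor
  · intro h
    rw [← cfc_rpow_mul_cfc_rpow hM hp, ← mul_assoc, h, zero_mul]
  · intro h
    rw [← mul_cfc_rpow_sub_one hM hp, ← mul_assoc, h, zero_mul]

theorem sandTr_eq_zero_iff {z : ℝ} (hz : z ≠ 0) {A Y : Matrix ι ι ℂ} (hA : A.IsHermitian)
    (hY : Y.PosSemidef) : sandTr z A Y = 0 ↔ Y * A = 0 := by
  have hM := posSemidef_sandwich hA hY
  constructor
  · intro h
    have h0 := eq_zero_of_rtr_eq_zero (cfc_posSemidef hM.1 fun _ hx =>
      Real.rpow_nonneg (spectrum_nonneg hM hx) _) h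
    refine mul_eq_zero_of_sandwich_eq_zero hA hY ?_
    rw [← cfc_rpow_mul_cfc_rpow hM hz, h0, zero_mul]
  · intro h
    have h0 : A * Y * A = 0 := by rw [mul_assoc, h, mul_zero]
    have h1 : cfc (fun x : ℝ => x ^ z) (A * Y * A) = 0 := by
      rw [← mul_cfc_rpow_sub_one hM hz, h0, zero_mul]
    rw [sandTr, h1]
    simp [rtr]

/-- The projection onto the kernel of a Hermitian matrix. -/
def kerProj (Y : Matrix ι ι ℂ) : Matrix ι ι ℂ := cfc (fun x : ℝ => if x = 0 then (1 : ℝ) else 0) Y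

theorem posSemidef_kerProj {Y : Matrix ι ι ℂ} (hY : Y.IsHermitian) : (kerProj Y).PosSemidef :=
  cfc_posSemidef hY fun x _ => by split_ifs <;> norm_num

theorem kerProj_mul_self {Y : Matrix ι ι ℂ} (hY : Y.IsHermitian) : kerProj Y * Y = 0 := by
  have : kerProj Y * Y = kerProj Y * cfc (fun x : ℝ => x) Y := by rw [cfc_self hY]
  rw [this, kerProj, cfc_mul', ← cfc_zero ℝ Y]
  exact cfc_congr fun x _ => by
    by_cases h : x = 0 <;> simp [h]

theorem self_mul_cfc_inv {Y : Matrix ι ι ℂ} (hY : Y.IsHermitian) :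
    Y * cfc (fun x : ℝ => x⁻¹) Y = 1 - kerProj Y := by
  have : Y * cfc (fun x : ℝ => x⁻¹) Y = cfc (fun x : ℝ => x) Y * cfc (fun x : ℝ => x⁻¹) Y := by
    rw [cfc_self hY]
  rw [this, cfc_mul', kerProj, ← cfc_eq_one hY,
    ← cfc_sub _ _ _ (continuousOn_spectrum _ _) (continuousOn_spectrum _ _)]
  exact cfc_congr fun x _ => by
    by_cases h : x = 0 <;> simp [h]

theorem msupp_mul_le {ι : Type*} [Fintype ι] (Y W : Matrix ι ι ℂ) : msupp (Y * W) ≤ msupp Y := by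
  rw [msupp, msupp, mulVecLin_mul]
  exact LinearMap.range_comp_le_range _ _

theorem eq_mul_of_kerProj_mul_eq_zero {X Y : Matrix ι ι ℂ} (hY : Y.IsHermitian)
    (h : kerProj Y * X = 0) : X = Y * (cfc (fun x : ℝ => x⁻¹) Y * X) := by
  rw [← mul_assoc, self_mul_cfc_inv hY, sub_mul, h, one_mul, sub_zero]

theorem msupp_le_iff {X Y : Matrix ι ι ℂ} (hY : Y.IsHermitian) :
    msupp X ≤ msupp Y ↔ kerProj Y * X = 0 := by
  constructor
  · intro h
    refine mulVec_injective (funext fun v => ?_)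
    obtain ⟨w, hw⟩ := h ⟨v, rfl⟩
    simp only [mulVecLin_apply] at hw
    rw [← mulVec_mulVec, ← hw, mulVec_mulVec, kerProj_mul_self hY, zero_mulVec, zero_mulVec]
  · intro h
    rw [eq_mul_of_kerProj_mul_eq_zero hY h]
    exact msupp_mul_le _ _

theorem msupp_dtens_le {a b : ℕ} {X Y : Matrix (Fin a) (Fin a) ℂ} {Z W : Matrix (Fin b) (Fin b) ℂ}
    (hY : Y.IsHermitian) (hW : W.IsHermitian) (h1 : msupp X ≤ msupp Y) (h2 : msupp Z ≤ msupp W) :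
    msupp (dtens X Z) ≤ msupp (dtens Y W) := by
  rw [eq_mul_of_kerProj_mul_eq_zero hY ((msupp_le_iff hY).1 h1),
    eq_mul_of_kerProj_mul_eq_zero hW ((msupp_le_iff hW).1 h2), ← dtens_mul]
  exact msupp_mul_le _ _

end Support

section Convex

variable {ι : Type*} [Fintype ι] [DecidableEq ι]

/-! ### The convex functional `Y ↦ Tr (A Y⁻¹ A)^z`, `z ≥ 1` -/

/-- The inverse on the support. -/
def pinv (Y : Matrix ι ι ℂ) : Matrix ι ι ℂ := cfc (fun x : ℝ => x⁻¹) Y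

theorem posSemidef_pinv {Y : Matrix ι ι ℂ} (hY : Y.PosSemidef) : (pinv Y).PosSemidef :=
  cfc_posSemidef hY.1 fun _ hx => inv_nonneg.2 (spectrum_nonneg hY hx)

theorem posDef_pinv {Y : Matrix ι ι ℂ} (hY : Y.PosDef) : (pinv Y).PosDef :=
  cfc_posDef hY.1 fun _ hx => inv_pos.2 (spectrum_pos hY hx)

theorem mul_pinv {Y : Matrix ι ι ℂ} (hY : Y.PosDef) : Y * pinv Y = 1 := by
  have : kerProj Y = 0 := by
    have h := kerProj_mul_self hY.1
    exact (hY.isUnit.mul_left_eq_zero).1 h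
  rw [pinv, self_mul_cfc_inv hY.1, this, sub_zero]

theorem pinv_mul {Y : Matrix ι ι ℂ} (hY : Y.PosDef) : pinv Y * Y = 1 :=
  mul_eq_one_comm.1 (mul_pinv hY)

theorem continuousOn_pinv : ContinuousOn (pinv : Matrix ι ι ℂ → Matrix ι ι ℂ) {Y | Y.PosDef} :=
  continuousOn_cfc_posDef fun _ hx => (continuousAt_inv₀ (ne_of_gt hx)).continuousWithinAt

/-- Minus the gradient of `Y ↦ sandTr z A (pinv Y)`, up to the factor `z`. -/
def invGrad (z : ℝ) (A Y : Matrix ι ι ℂ) : Matrix ι ι ℂ := pinv Y * sandGrad z A (pinv Y) * pinv Y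

theorem rtr_invGrad_self {z : ℝ} (hz : z ≠ 0) {A Y : Matrix ι ι ℂ} (hA : A.IsHermitian)
    (hY : Y.PosDef) : rtr (invGrad z A Y * Y) = sandTr z A (pinv Y) := by
  rw [invGrad, mul_assoc, pinv_mul hY, mul_one, rtr_mul_comm,
    rtr_sandGrad_self hz hA (posDef_pinv hY).posSemidef]

theorem posSemidef_invGrad (z : ℝ) {A Y : Matrix ι ι ℂ} (hA : A.IsHermitian)
    (hY : Y.PosSemidef) : (invGrad z A Y).PosSemidef :=
  posSemidef_sandwich (posSemidef_pinv hY).1 (posSemidef_sandGrad z hA (posSemidef_pinv hY))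

theorem tangent_le_sandTr {z : ℝ} (hz : 1 ≤ z) {A X Y : Matrix ι ι ℂ}
    (hA : A.IsHermitian) (hX : X.PosSemidef) (hY : Y.PosSemidef) :
    sandTr z A Y + z * rtr (sandGrad z A Y * (X - Y)) ≤ sandTr z A X := by
  have := le_rtr_cfc_rpow hz (posSemidef_sandwich hA hX) (posSemidef_sandwich hA hY)
  rw [sandGrad, rtr_sandwich_mul, mul_sub, sub_mul]
  exact this

theorem sandTr_pinv_tangent {z : ℝ} (hz : 1 ≤ z) {A X Y : Matrix ι ι ℂ}
    (hA : A.IsHermitian) (hX : X.PosDef) (hY : Y.PosDef) :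
    sandTr z A (pinv Y) ≤ sandTr z A (pinv X) + z * rtr (invGrad z A Y * (X - Y)) := by
  have pX := posDef_pinv hX
  have pY := posDef_pinv hY
  have h1 := tangent_le_sandTr hz hA pX.posSemidef pY.posSemidef
  have h2 : (pinv X - pinv Y) * X * (pinv X - pinv Y) =
      pinv X - pinv Y + pinv Y * (X - Y) * pinv Y := by
    simp only [sub_mul, mul_sub, pinv_mul hX, one_mul, pinv_mul hY]
    rw [mul_assoc (pinv Y) X (pinv X), mul_pinv hX, mul_one]
    abel
  have h3 := rtr_mul_nonneg (posSemidef_sandGrad z hA pY.posSemidef)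
    (posSemidef_sandwich (pX.1.sub pY.1) hX.posSemidef)
  rw [h2, mul_add, rtr_add, ← rtr_sandwich_mul] at h3
  have h4 := mul_nonneg (zero_le_one.trans hz) h3
  rw [invGrad]
  linarith

theorem continuousOn_sandTr_pinv {z : ℝ} (hz : 0 ≤ z) {A : Matrix ι ι ℂ} (hA : A.IsHermitian) :
    ContinuousOn (fun Y => sandTr z A (pinv Y)) {Y | Y.PosDef} :=
  continuous_rtr.comp_continuousOn
    ((continuousOn_cfc_isHermitian (Real.continuous_rpow_const hz)).comp
      ((continuous_sandwich A).comp_continuousOn continuousOn_pinv)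
      fun _ hY => (posSemidef_sandwich hA (posDef_pinv hY).posSemidef).1)

theorem continuousOn_invGrad {z : ℝ} (hz : 1 ≤ z) {A : Matrix ι ι ℂ} (hA : A.IsHermitian) :
    ContinuousOn (invGrad z A) {Y | Y.PosDef} := by
  have h : ContinuousOn (fun Y => sandGrad z A (pinv Y)) {Y | Y.PosDef} :=
    (continuous_sandwich A).comp_continuousOn
      ((continuousOn_cfc_isHermitian (Real.continuous_rpow_const (sub_nonneg.2 hz))).comp
        ((continuous_sandwich A).comp_continuousOn continuousOn_pinv)
        fun _ hY => (posSemidef_sandwich hA (posDef_pinv hY).posSemidef).1)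
  exact (continuousOn_pinv.mul h).mul continuousOn_pinv

theorem exists_invTr_optimal {z : ℝ} (hz : 1 ≤ z) {A : Matrix ι ι ℂ} (hA : A.IsHermitian)
    {S : Set (Matrix ι ι ℂ)} (hpsd : ∀ X ∈ S, X.PosSemidef)
    (hcvx : Convex ℝ S) (hcpt : IsCompact S) (hne : S.Nonempty) {ε : ℝ} (hε : 0 < ε) :
    ∃ σ ∈ S, ∀ X ∈ S, rtr (invGrad z A (σ + ε • (1 : Matrix ι ι ℂ)) * X) ≤
      sandTr z A (pinv (σ + ε • (1 : Matrix ι ι ℂ))) := by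
  have hz0 : 0 < z := by linarith
  obtain ⟨σ, hσ, h⟩ := exists_optimal' hpsd hcvx hcpt hne hε
    (continuousOn_sandTr_pinv hz0.le hA) (continuousOn_invGrad hz hA) hz0
    (fun X Y hX hY => sandTr_pinv_tangent hz hA hX hY)
    (fun X hX => posSemidef_invGrad z hA hX.posSemidef)
  refine ⟨σ, hσ, fun X hX => (h X hX).trans_eq ?_⟩
  exact rtr_invGrad_self hz0.ne' hA (posDef_add_smul_one (hpsd σ hσ) hε)

theorem sandTr_pinv_pos {z : ℝ} (hz : z ≠ 0) {A Y : Matrix ι ι ℂ} (hA : A.IsHermitian)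
    (hA0 : A ≠ 0) (hY : Y.PosDef) : 0 < sandTr z A (pinv Y) := by
  have pY := posDef_pinv hY
  refine lt_of_le_of_ne (sandTr_nonneg z hA pY.posSemidef) fun h => hA0 ?_
  have h1 := (sandTr_eq_zero_iff hz hA pY.posSemidef).1 h.symm
  exact (pY.isUnit.mul_right_eq_zero).1 h1

theorem sandTr_pinv_anti {z : ℝ} (hz : 1 ≤ z) {A X : Matrix ι ι ℂ} (hA : A.IsHermitian)
    (hX : X.PosSemidef) {δ ε : ℝ} (hδ : 0 < δ) (hδε : δ ≤ ε) :
    sandTr z A (pinv (X + ε • (1 : Matrix ι ι ℂ))) ≤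
      sandTr z A (pinv (X + δ • (1 : Matrix ι ι ℂ))) := by
  have hε := hδ.trans_le hδε
  have h := sandTr_pinv_tangent hz hA (posDef_add_smul_one hX hδ) (posDef_add_smul_one hX hε)
  have e : X + δ • (1 : Matrix ι ι ℂ) - (X + ε • (1 : Matrix ι ι ℂ)) =
      (δ - ε) • (1 : Matrix ι ι ℂ) := by rw [sub_smul]; abel
  rw [e, mul_smul_comm, mul_one, rtr_smul] at h
  have h1 := rtr_nonneg (posSemidef_invGrad z hA (posDef_add_smul_one hX hε).posSemidef)
  have h2 : z * ((δ - ε) * rtr (invGrad z A (X + ε • (1 : Matrix ι ι ℂ)))) ≤ 0 :=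
    mul_nonpos_of_nonneg_of_nonpos (by linarith)
      (mul_nonpos_of_nonpos_of_nonneg (by linarith) h1)
  linarith

theorem pinv_dtens {a b : ℕ} {A : Matrix (Fin a) (Fin a) ℂ} {B : Matrix (Fin b) (Fin b) ℂ}
    (hA : A.PosSemidef) (hB : B.PosSemidef) : pinv (dtens A B) = dtens (pinv A) (pinv B) :=
  cfc_inv_dtens hA hB

theorem sandTr_pinv_dtens {a b : ℕ} (z : ℝ) {A Y : Matrix (Fin a) (Fin a) ℂ}
    {B W : Matrix (Fin b) (Fin b) ℂ} (hA : A.IsHermitian) (hB : B.IsHermitian)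
    (hY : Y.PosSemidef) (hW : W.PosSemidef) :
    sandTr z (dtens A B) (pinv (dtens Y W)) = sandTr z A (pinv Y) * sandTr z B (pinv W) := by
  rw [pinv_dtens hY hW, sandTr_dtens z hA hB (posSemidef_pinv hY) (posSemidef_pinv hW)]

theorem invGrad_dtens {a b : ℕ} (z : ℝ) {A Y : Matrix (Fin a) (Fin a) ℂ}
    {B W : Matrix (Fin b) (Fin b) ℂ} (hA : A.IsHermitian) (hB : B.IsHermitian)
    (hY : Y.PosSemidef) (hW : W.PosSemidef) :
    invGrad z (dtens A B) (dtens Y W) = dtens (invGrad z A Y) (invGrad z B W) := by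
  rw [invGrad, pinv_dtens hY hW,
    sandGrad_dtens z hA hB (posSemidef_pinv hY) (posSemidef_pinv hW), dtens_mul, dtens_mul]
  rfl

theorem isHermitian_dtens {a b : ℕ} {A : Matrix (Fin a) (Fin a) ℂ} {B : Matrix (Fin b) (Fin b) ℂ}
    (hA : A.IsHermitian) (hB : B.IsHermitian) : (dtens A B).IsHermitian := by
  rw [IsHermitian, ← star_eq_conjTranspose, dtens_star, star_eq_conjTranspose,
    star_eq_conjTranspose, hA.eq, hB.eq]

theorem sandTr_pinv_bound_perturbed {a b : ℕ} (ha : 1 ≤ a) (hb : 1 ≤ b) {z : ℝ} (hz : 1 ≤ z)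
    {A : Matrix (Fin a) (Fin a) ℂ} {B : Matrix (Fin b) (Fin b) ℂ}
    (hA : A.IsHermitian) (hB : B.IsHermitian) (hA0 : A ≠ 0) (hB0 : B ≠ 0)
    {S : (d : ℕ) → Set (Matrix (Fin d) (Fin d) ℂ)}
    (hS : Assumption1' S) (hSa : (S a).Nonempty) (hSb : (S b).Nonempty) {ε : ℝ} (hε : 0 < ε) :
    ∃ σ ∈ S a, ∃ τ ∈ S b, ∀ X ∈ S (a * b), ∀ c,
      Tendsto (fun δ : ℝ => sandTr z (dtens A B) (pinv (X + δ • (1 : Matrix _ _ ℂ))))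
        (𝓝[>] 0) (𝓝 c) →
      sandTr z A (pinv (σ + ε • (1 : Matrix _ _ ℂ))) *
        sandTr z B (pinv (τ + ε • (1 : Matrix _ _ ℂ))) ≤ c := by
  have hab : 1 ≤ a * b := Nat.mul_pos ha hb
  have hz0 : 0 < z := by linarith
  obtain ⟨σ, hσ, h1⟩ := exists_invTr_optimal hz hA (hS.psd a ha) (hS.convex a ha)
    (hS.compact a ha) hSa hε
  obtain ⟨τ, hτ, h2⟩ := exists_invTr_optimal hz hB (hS.psd b hb) (hS.convex b hb)
    (hS.compact b hb) hSb hε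
  refine ⟨σ, hσ, τ, hτ, fun X hX c hc => ?_⟩
  have pσ := posDef_add_smul_one (hS.psd a ha σ hσ) hε
  have pτ := posDef_add_smul_one (hS.psd b hb τ hτ) hε
  set σ' := σ + ε • (1 : Matrix _ _ ℂ)
  set τ' := τ + ε • (1 : Matrix _ _ ℂ)
  have h3 := polar_bound_dtens hS ha hb (posSemidef_invGrad z hA pσ.posSemidef)
    (posSemidef_invGrad z hB pτ.posSemidef) (sandTr_pinv_pos hz0.ne' hA hA0 pσ)
    (sandTr_pinv_pos hz0.ne' hB hB0 pτ) h1 h2 X hX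
  have pAB := isHermitian_dtens hA hB
  set K := rtr (dtens (invGrad z A σ') (invGrad z B τ'))
  set f := sandTr z A (pinv σ') * sandTr z B (pinv τ')
  have h4 : ∀ δ ∈ Ioi (0 : ℝ), f - z * (δ * K) ≤
      sandTr z (dtens A B) (pinv (X + δ • (1 : Matrix _ _ ℂ))) := by
    intro δ hδ
    have h5 := sandTr_pinv_tangent hz pAB (posDef_add_smul_one (hS.psd _ hab X hX) hδ)
      (posDef_dtens pσ pτ)
    rw [mul_sub, rtr_sub, rtr_invGrad_self hz0.ne' pAB (posDef_dtens pσ pτ),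
      invGrad_dtens z hA hB pσ.posSemidef pτ.posSemidef,
      sandTr_pinv_dtens z hA hB pσ.posSemidef pτ.posSemidef, mul_add, rtr_add, mul_smul_comm,
      mul_one, rtr_smul] at h5
    nlinarith [mul_le_mul_of_nonneg_left h3 hz0.le]
  have h6 : Tendsto (fun δ : ℝ => f - z * (δ * K)) (𝓝[>] 0) (𝓝 f) := by
    have : Continuous fun δ : ℝ => f - z * (δ * K) := by fun_prop
    have h7 := this.tendsto 0
    simp only [zero_mul, mul_zero, sub_zero] at h7
    exact h7.mono_left nhdsWithin_le_nhds
  exact le_of_tendsto_of_tendsto h6 hc (eventually_nhdsWithin_of_forall h4)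

theorem sandTr_pinv_bound {a b : ℕ} (ha : 1 ≤ a) (hb : 1 ≤ b) {z : ℝ} (hz : 1 ≤ z)
    {A : Matrix (Fin a) (Fin a) ℂ} {B : Matrix (Fin b) (Fin b) ℂ}
    (hA : A.IsHermitian) (hB : B.IsHermitian) (hA0 : A ≠ 0) (hB0 : B ≠ 0)
    {S : (d : ℕ) → Set (Matrix (Fin d) (Fin d) ℂ)}
    (hS : Assumption1' S) (hSa : (S a).Nonempty) (hSb : (S b).Nonempty) :
    ∃ σ ∈ S a, ∃ τ ∈ S b, ∀ X ∈ S (a * b), ∀ c,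
      Tendsto (fun δ : ℝ => sandTr z (dtens A B) (pinv (X + δ • (1 : Matrix _ _ ℂ))))
        (𝓝[>] 0) (𝓝 c) →
      ∀ ε : ℝ, 0 < ε → sandTr z A (pinv (σ + ε • (1 : Matrix _ _ ℂ))) *
        sandTr z B (pinv (τ + ε • (1 : Matrix _ _ ℂ))) ≤ c := by
  have hz0 : 0 < z := by linarith
  set ε : ℕ → ℝ := fun n => 1 / ((n : ℝ) + 1) with hεdef
  have hε : ∀ n, 0 < ε n := fun n => Nat.one_div_pos_of_nat
  have hεl : Tendsto ε atTop (𝓝 0) := tendsto_one_div_add_atTop_nhds_zero_nat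
  choose σ hσ τ hτ h using fun n => sandTr_pinv_bound_perturbed ha hb hz hA hB hA0 hB0 hS hSa hSb
    (hε n)
  obtain ⟨⟨σ₀, τ₀⟩, ⟨hσ₀, hτ₀⟩, φ, hφ, hlim⟩ :=
    ((hS.compact a ha).prod (hS.compact b hb)).tendsto_subseq
      (x := fun n => (σ n, τ n)) fun n => ⟨hσ n, hτ n⟩
  have hεφ : Tendsto (fun n => ε (φ n)) atTop (𝓝 0) := hεl.comp hφ.tendsto_atTop
  have key : ∀ {d : ℕ} (_ : 1 ≤ d) {C : Matrix (Fin d) (Fin d) ℂ} (_ : C.IsHermitian)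
      {Y : ℕ → Matrix (Fin d) (Fin d) ℂ} {Y₀ : Matrix (Fin d) (Fin d) ℂ}
      (_ : ∀ n, Y n ∈ S d) (_ : Y₀ ∈ S d) (_ : Tendsto Y atTop (𝓝 Y₀)) {η : ℝ} (_ : 0 < η),
      Tendsto (fun n => sandTr z C (pinv (Y n + η • (1 : Matrix (Fin d) (Fin d) ℂ)))) atTop
        (𝓝 (sandTr z C (pinv (Y₀ + η • (1 : Matrix (Fin d) (Fin d) ℂ))))) := by
    intro d hd C hC Y Y₀ hY hY₀ hl η hη
    exact ((continuousOn_sandTr_pinv hz0.le hC) _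
      (posDef_add_smul_one (hS.psd d hd _ hY₀) hη)).tendsto.comp
      (tendsto_nhdsWithin_iff.2 ⟨hl.add_const _, Eventually.of_forall fun n =>
        posDef_add_smul_one (hS.psd d hd _ (hY n)) hη⟩)
  refine ⟨σ₀, hσ₀, τ₀, hτ₀, fun X hX c hc η hη => ?_⟩
  have l1 := key ha hA (Y := fun n => σ (φ n)) (fun n => hσ _) hσ₀ hlim.fst_nhds hη
  have l2 := key hb hB (Y := fun n => τ (φ n)) (fun n => hτ _) hτ₀ hlim.snd_nhds hη
  refine le_of_tendsto (l1.mul l2) ?_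
  filter_upwards [hεφ.eventually (eventually_le_nhds hη)] with n hn
  refine le_trans (mul_le_mul (sandTr_pinv_anti hz hA (hS.psd a ha _ (hσ _)) (hε _) hn)
    (sandTr_pinv_anti hz hB (hS.psd b hb _ (hτ _)) (hε _) hn) ?_ ?_) (h (φ n) X hX c hc)
  · exact (sandTr_pinv_pos hz0.ne' hB hB0
      (posDef_add_smul_one (hS.psd b hb _ (hτ _)) hη)).le
  · exact (sandTr_pinv_pos hz0.ne' hA hA0
      (posDef_add_smul_one (hS.psd a ha _ (hσ _)) (hε _))).le

end Convex

section Limit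

variable {ι : Type*} [Fintype ι] [DecidableEq ι]

/-! ### Removing the regularization of the inverse -/

theorem cfc_add_smul_one {Y : Matrix ι ι ℂ} (hY : Y.IsHermitian) (f : ℝ → ℝ) (ε : ℝ) :
    cfc f (Y + ε • (1 : Matrix ι ι ℂ)) = cfc (fun x => f (x + ε)) Y := by
  set U : Matrix ι ι ℂ := (hY.eigenvectorUnitary : Matrix ι ι ℂ) with hU
  have hUU : star U * U = 1 := Unitary.coe_star_mul_self _
  have hUU' : U * star U = 1 := Unitary.coe_mul_star_self _
  have h1 : Y + ε • (1 : Matrix ι ι ℂ) =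
      U * Matrix.diagonal (fun i => ((hY.eigenvalues i + ε : ℝ) : ℂ)) * star U := by
    have h2 : Matrix.diagonal (fun i => ((hY.eigenvalues i + ε : ℝ) : ℂ)) =
        Matrix.diagonal (fun i => (hY.eigenvalues i : ℂ)) + ε • (1 : Matrix ι ι ℂ) := by
      ext i j
      by_cases h : i = j
      · subst h
        simp [Matrix.smul_apply]
      · simp [Matrix.smul_apply, h]
    rw [h2, mul_add, add_mul, ← eq_eigen hY, mul_smul_comm, mul_one, smul_mul_assoc, hUU']
  rw [h1, cfc_unitary_conj_diagonal hUU, cfc_eq_eigen hY]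

theorem tendsto_cfc_fun {κ : Type*} {l : Filter κ} {f : κ → ℝ → ℝ} {f₀ : ℝ → ℝ}
    {Y : Matrix ι ι ℂ} (hY : Y.IsHermitian)
    (h : ∀ x ∈ spectrum ℝ Y, Tendsto (fun k => f k x) l (𝓝 (f₀ x))) :
    Tendsto (fun k => cfc (f k) Y) l (𝓝 (cfc f₀ Y)) := by
  simp only [cfc_eq_eigen hY]
  have hd : Tendsto (fun k => Matrix.diagonal (fun i => (f k (hY.eigenvalues i) : ℂ))) l
      (𝓝 (Matrix.diagonal (fun i => (f₀ (hY.eigenvalues i) : ℂ)))) := by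
    have hc : Continuous (Matrix.diagonal : (ι → ℂ) → Matrix ι ι ℂ) :=
      continuous_id.matrix_diagonal
    refine (hc.tendsto _).comp (tendsto_pi_nhds.2 fun i => ?_)
    exact (Complex.continuous_ofReal.tendsto _).comp (h _ (hY.eigenvalues_mem_spectrum_real i))
  exact (tendsto_const_nhds.mul hd).mul tendsto_const_nhds

theorem pinv_add_smul_one {Y : Matrix ι ι ℂ} (hY : Y.IsHermitian) (ε : ℝ) :
    pinv (Y + ε • (1 : Matrix ι ι ℂ)) =
      ε⁻¹ • kerProj Y + cfc (fun x : ℝ => if x = 0 then 0 else (x + ε)⁻¹) Y := by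
  rw [pinv, cfc_add_smul_one hY, kerProj, ← cfc_const_mul _ _ _ (continuousOn_spectrum _ _),
    ← cfc_add _ _ _ (continuousOn_spectrum _ _) (continuousOn_spectrum _ _)]
  exact cfc_congr fun x _ => by
    by_cases h : x = 0 <;> simp [h]

theorem tendsto_sandTr_pinv {z : ℝ} (hz : 0 ≤ z) {A Y : Matrix ι ι ℂ} (hA : A.IsHermitian)
    (hY : Y.PosSemidef) (h : kerProj Y * A = 0) :
    Tendsto (fun δ : ℝ => sandTr z A (pinv (Y + δ • (1 : Matrix ι ι ℂ)))) (𝓝[>] 0)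
      (𝓝 (sandTr z A (pinv Y))) := by
  set g : ℝ → ℝ → ℝ := fun δ x => if x = 0 then 0 else (x + δ)⁻¹ with hg
  have h1 : ∀ δ, sandTr z A (pinv (Y + δ • (1 : Matrix ι ι ℂ))) = sandTr z A (cfc (g δ) Y) := by
    intro δ
    rw [sandTr, sandTr, pinv_add_smul_one hY.1, mul_add, add_mul, mul_smul_comm, smul_mul_assoc,
      mul_assoc A (kerProj Y) A, h, mul_zero, smul_zero, zero_add]
  simp only [h1]
  have h2 : Tendsto (fun δ : ℝ => cfc (g δ) Y) (𝓝[>] 0) (𝓝 (pinv Y)) := by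
    refine tendsto_cfc_fun hY.1 fun x _ => ?_
    by_cases hx : x = 0
    · simp [hg, hx]
    · simp only [hg, hx, if_false]
      have : Tendsto (fun δ : ℝ => (x + δ)⁻¹) (𝓝 0) (𝓝 (x + 0)⁻¹) :=
        (tendsto_const_nhds.add tendsto_id).inv₀ (by simpa using hx)
      rw [add_zero] at this
      exact this.mono_left nhdsWithin_le_nhds
  have hH : ∀ C : Matrix ι ι ℂ, C.IsHermitian → (A * C * A).IsHermitian := by
    intro C hC
    have := isHermitian_mul_mul_conjTranspose A hC
    rwa [hA.eq] at this
  exact (continuous_rtr.tendsto _).comp (tendsto_cfc (Real.continuous_rpow_const hz)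
    (fun δ => hH _ (cfc_isHermitian _ _)) (hH _ (cfc_isHermitian _ _))
    (((continuous_sandwich A).tendsto _).comp h2))

theorem kerProj_mul_eq_zero_of_bounded {z : ℝ} (hz : 1 ≤ z) {A Y : Matrix ι ι ℂ}
    (hA : A.IsHermitian) (hY : Y.PosSemidef) {K : ℝ}
    (hK : ∀ ε ∈ Ioc (0 : ℝ) 1, sandTr z A (pinv (Y + ε • (1 : Matrix ι ι ℂ))) ≤ K) :
    kerProj Y * A = 0 := by
  have hN := posSemidef_kerProj hY.1
  have hM := posSemidef_sandwich hA hN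
  refine mul_eq_zero_of_sandwich_eq_zero hA hN (eq_zero_of_rtr_eq_zero hM ?_)
  refine le_antisymm ?_ (rtr_nonneg hM)
  set t := rtr (A * kerProj Y * A) with ht
  set m := rtr (1 : Matrix ι ι ℂ)
  have h1 : ∀ ε ∈ Ioc (0 : ℝ) 1, z * t ≤ ε * (K + (z - 1) * m) := by
    intro ε hε
    have pY := posDef_pinv (posDef_add_smul_one hY hε.1)
    have h2 := le_rtr_cfc_rpow hz (posSemidef_sandwich hA pY.posSemidef)
      (PosSemidef.one (n := ι) (R := ℂ))
    have e1 : ∀ w : ℝ, cfc (fun x : ℝ => x ^ w) (1 : Matrix ι ι ℂ) = 1 := by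
      intro w
      rw [cfc_apply_one]
      simp
    rw [e1, e1, one_mul, rtr_sub] at h2
    have h3 := h2.trans (hK ε hε)
    have hR : (cfc (fun x : ℝ => if x = 0 then 0 else (x + ε)⁻¹) Y).PosSemidef :=
      cfc_posSemidef hY.1 fun x hx => by
        have := spectrum_nonneg hY hx
        have := hε.1
        split_ifs
        · exact le_rfl
        · positivity
    have h4 := rtr_nonneg (posSemidef_sandwich hA hR)
    rw [pinv_add_smul_one hY.1, mul_add, add_mul, mul_smul_comm, smul_mul_assoc, rtr_add,
      rtr_smul, ← ht] at h3
    have h5 : z * (ε⁻¹ * t) ≤ K + (z - 1) * m := by nlinarith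
    calc z * t = ε * (z * (ε⁻¹ * t)) := by have := hε.1.ne'; field_simp
      _ ≤ _ := mul_le_mul_of_nonneg_left h5 hε.1.le
  have h6 : Tendsto (fun ε : ℝ => ε * (K + (z - 1) * m)) (𝓝[Ioc (0 : ℝ) 1] 0) (𝓝 0) := by
    have : Continuous fun ε : ℝ => ε * (K + (z - 1) * m) := by fun_prop
    have h7 := this.tendsto 0
    rw [zero_mul] at h7
    exact h7.mono_left nhdsWithin_le_nhds
  have : (𝓝[Ioc (0 : ℝ) 1] 0).NeBot := by
    rw [nhdsWithin_Ioc_eq_nhdsGT zero_lt_one]; infer_instance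
  have h8 := ge_of_tendsto h6 (eventually_nhdsWithin_of_forall h1)
  nlinarith

theorem exists_sandTr_pinv_mul_le {a b : ℕ} (ha : 1 ≤ a) (hb : 1 ≤ b) {z : ℝ} (hz : 1 ≤ z)
    {A : Matrix (Fin a) (Fin a) ℂ} {B : Matrix (Fin b) (Fin b) ℂ}
    (hA : A.IsHermitian) (hB : B.IsHermitian) (hA0 : A ≠ 0) (hB0 : B ≠ 0)
    {S : (d : ℕ) → Set (Matrix (Fin d) (Fin d) ℂ)}
    (hS : Assumption1' S) (hSa : (S a).Nonempty) (hSb : (S b).Nonempty) :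
    ∃ σ ∈ S a, ∃ τ ∈ S b, ∀ X ∈ S (a * b), kerProj X * dtens A B = 0 →
      kerProj σ * A = 0 ∧ kerProj τ * B = 0 ∧
      sandTr z A (pinv σ) * sandTr z B (pinv τ) ≤ sandTr z (dtens A B) (pinv X) := by
  have hab : 1 ≤ a * b := Nat.mul_pos ha hb
  have hz0 : 0 < z := by linarith
  obtain ⟨σ, hσ, τ, hτ, h⟩ := sandTr_pinv_bound ha hb hz hA hB hA0 hB0 hS hSa hSb
  refine ⟨σ, hσ, τ, hτ, fun X hX hsupp => ?_⟩
  have h1 := h X hX _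
    (tendsto_sandTr_pinv hz0.le (isHermitian_dtens hA hB) (hS.psd _ hab X hX) hsupp)
  set c := sandTr z (dtens A B) (pinv X)
  have pσ := hS.psd a ha σ hσ
  have pτ := hS.psd b hb τ hτ
  have fpos := fun (ε : ℝ) (hε : 0 < ε) =>
    sandTr_pinv_pos hz0.ne' hA hA0 (posDef_add_smul_one pσ hε)
  have gpos := fun (ε : ℝ) (hε : 0 < ε) =>
    sandTr_pinv_pos hz0.ne' hB hB0 (posDef_add_smul_one pτ hε)
  have hσA : kerProj σ * A = 0 := by
    refine kerProj_mul_eq_zero_of_bounded hz hA pσ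
      (K := c / sandTr z B (pinv (τ + (1 : ℝ) • (1 : Matrix _ _ ℂ)))) fun ε hε => ?_
    rw [le_div_iff₀ (gpos 1 one_pos)]
    exact (mul_le_mul_of_nonneg_left (sandTr_pinv_anti hz hB pτ hε.1 hε.2)
      (fpos ε hε.1).le).trans (h1 ε hε.1)
  have hτB : kerProj τ * B = 0 := by
    refine kerProj_mul_eq_zero_of_bounded hz hB pτ
      (K := c / sandTr z A (pinv (σ + (1 : ℝ) • (1 : Matrix _ _ ℂ)))) fun ε hε => ?_
    rw [le_div_iff₀' (fpos 1 one_pos)]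
    exact (mul_le_mul_of_nonneg_right (sandTr_pinv_anti hz hA pσ hε.1 hε.2)
      (gpos ε hε.1).le).trans (h1 ε hε.1)
  exact ⟨hσA, hτB, le_of_tendsto ((tendsto_sandTr_pinv hz0.le hA pσ hσA).mul
    (tendsto_sandTr_pinv hz0.le hB pτ hτB)) (eventually_nhdsWithin_of_forall h1)⟩

end Limit

section Infimum

/-! ### Additivity of infima -/

theorem iInf_ne_top_of_exists {X : Type*} {S : Set X} {good : X → Prop} [DecidablePred good]
    {q : X → ℝ} {D : X → EReal} (hD : ∀ σ ∈ S, D σ = if good σ then (q σ : EReal) else ⊤)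
    (hne : ∃ σ ∈ S, good σ) : (⨅ σ ∈ S, D σ) ≠ ⊤ := by
  obtain ⟨σ, hσ, hg⟩ := hne
  intro h
  have := (iInf₂_le σ hσ : (⨅ σ ∈ S, D σ) ≤ D σ)
  rw [h, hD σ hσ, if_pos hg, top_le_iff] at this
  exact EReal.coe_ne_top _ this

theorem exists_lt_of_iInf_lt {X : Type*} {S : Set X} {good : X → Prop} [DecidablePred good]
    {q : X → ℝ} {D : X → EReal} (hD : ∀ σ ∈ S, D σ = if good σ then (q σ : EReal) else ⊤)
    {c : EReal} (hc : (⨅ σ ∈ S, D σ) < c) : ∃ σ ∈ S, good σ ∧ D σ < c := by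
  obtain ⟨σ, hσ, h⟩ := by simpa only [iInf_lt_iff, exists_prop] using hc
  refine ⟨σ, hσ, ?_, h⟩
  by_contra hg
  rw [hD σ hσ, if_neg hg] at h
  exact not_top_lt h

theorem iInf_additive {X₁ X₂ X₁₂ : Type*} {S₁ : Set X₁} {S₂ : Set X₂} {S₁₂ : Set X₁₂}
    {good₁ : X₁ → Prop} {good₂ : X₂ → Prop} {good₁₂ : X₁₂ → Prop}
    [DecidablePred good₁] [DecidablePred good₂] [DecidablePred good₁₂]
    {q₁ : X₁ → ℝ} {q₂ : X₂ → ℝ} {q₁₂ : X₁₂ → ℝ} {k : ℝ}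
    {D₁ : X₁ → EReal} {D₂ : X₂ → EReal} {D₁₂ : X₁₂ → EReal}
    (hD₁ : ∀ σ ∈ S₁, D₁ σ = if good₁ σ then ((k * Real.log (q₁ σ) : ℝ) : EReal) else ⊤)
    (hD₂ : ∀ σ ∈ S₂, D₂ σ = if good₂ σ then ((k * Real.log (q₂ σ) : ℝ) : EReal) else ⊤)
    (hD₁₂ : ∀ σ ∈ S₁₂, D₁₂ σ = if good₁₂ σ then ((k * Real.log (q₁₂ σ) : ℝ) : EReal) else ⊤)
    (op : X₁ → X₂ → X₁₂) (hop : ∀ σ ∈ S₁, ∀ τ ∈ S₂, op σ τ ∈ S₁₂)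
    (hpos₁ : ∀ σ ∈ S₁, good₁ σ → q₁ σ ≠ 0) (hpos₂ : ∀ σ ∈ S₂, good₂ σ → q₂ σ ≠ 0)
    (hmul : ∀ σ ∈ S₁, ∀ τ ∈ S₂, good₁ σ → good₂ τ →
      good₁₂ (op σ τ) ∧ q₁₂ (op σ τ) = q₁ σ * q₂ τ)
    (hopt : ∃ σ ∈ S₁, ∃ τ ∈ S₂, ∀ X ∈ S₁₂, good₁₂ X →
      good₁ σ ∧ good₂ τ ∧ k * Real.log (q₁ σ * q₂ τ) ≤ k * Real.log (q₁₂ X))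
    (hne₁ : ∃ σ ∈ S₁, good₁ σ) (hne₂ : ∃ σ ∈ S₂, good₂ σ) :
    (⨅ σ ∈ S₁₂, D₁₂ σ) = (⨅ σ ∈ S₁, D₁ σ) + ⨅ σ ∈ S₂, D₂ σ := by
  have hsum : ∀ σ ∈ S₁, ∀ τ ∈ S₂, good₁ σ → good₂ τ →
      D₁ σ + D₂ τ = ((k * Real.log (q₁ σ * q₂ τ) : ℝ) : EReal) := by
    intro σ hσ τ hτ h1 h2
    rw [hD₁ σ hσ, hD₂ τ hτ, if_pos h1, if_pos h2, ← EReal.coe_add,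
      Real.log_mul (hpos₁ σ hσ h1) (hpos₂ τ hτ h2), mul_add]
  refine le_antisymm ?_ ?_
  · refine EReal.le_add_of_forall_gt (Or.inr (iInf_ne_top_of_exists hD₂ hne₂)) (Or.inl (iInf_ne_top_of_exists hD₁ hne₁)) ?_
    intro a ha b hb
    obtain ⟨σ, hσ, gσ, hσa⟩ := exists_lt_of_iInf_lt hD₁ ha
    obtain ⟨τ, hτ, gτ, hτb⟩ := exists_lt_of_iInf_lt hD₂ hb
    obtain ⟨hg, hq⟩ := hmul σ hσ τ hτ gσ gτ
    calc (⨅ σ ∈ S₁₂, D₁₂ σ) ≤ D₁₂ (op σ τ) := iInf₂_le _ (hop σ hσ τ hτ)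
      _ = D₁ σ + D₂ τ := by rw [hsum σ hσ τ hτ gσ gτ, hD₁₂ _ (hop σ hσ τ hτ), if_pos hg, hq]
      _ ≤ a + b := add_le_add hσa.le hτb.le
  · obtain ⟨σ, hσ, τ, hτ, h⟩ := hopt
    refine le_iInf₂ fun X hX => ?_
    by_cases hg : good₁₂ X
    · obtain ⟨gσ, gτ, hle⟩ := h X hX hg
      calc _ ≤ D₁ σ + D₂ τ := add_le_add (iInf₂_le σ hσ) (iInf₂_le τ hτ)
        _ ≤ D₁₂ X := by
          rw [hsum σ hσ τ hτ gσ gτ, hD₁₂ X hX, if_pos hg]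
          exact_mod_cast hle
    · rw [hD₁₂ X hX, if_neg hg]
      exact le_top

end Infimum

section Renyi

variable {ι : Type*} [Fintype ι] [DecidableEq ι]

/-! ### The Rényi relative entropies on the boundary line -/

theorem IsState.ne_zero {ι : Type*} [Fintype ι] {ρ : Matrix ι ι ℂ} (hρ : IsState ρ) : ρ ≠ 0 := by
  rintro rfl
  simpa using hρ.2

theorem cfc_rpow_ne_zero {ρ : Matrix ι ι ℂ} (hρ : IsState ρ) {p : ℝ} (hp : p ≠ 0) :
    cfc (fun x : ℝ => x ^ p) ρ ≠ 0 := by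
  intro h
  have h1 := (mul_cfc_rpow_eq_zero_iff hρ.1 hp (1 : Matrix ι ι ℂ)).1 (by rw [h, mul_zero])
  exact hρ.ne_zero (by rwa [one_mul] at h1)

theorem cfc_rpow_posSemidef {ρ : Matrix ι ι ℂ} (hρ : ρ.PosSemidef) (p : ℝ) :
    (cfc (fun x : ℝ => x ^ p) ρ).PosSemidef :=
  cfc_posSemidef hρ.1 fun _ hx => Real.rpow_nonneg (spectrum_nonneg hρ hx) _

theorem Qaz_eq_of_lt_one {α : ℝ} (h0 : 0 < α) (h1 : α < 1) {ρ σ : Matrix ι ι ℂ}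
    (hρ : ρ.PosSemidef) (hσ : σ.PosSemidef) :
    Qaz α (1 - α) ρ σ =
      sandTr (1 - α) (cfc (fun x : ℝ => x ^ (α / (2 * (1 - α)))) ρ) σ := by
  have hz : 0 < 1 - α := sub_pos.2 h1
  rw [Qaz, div_self hz.ne', mpow_one hσ, mpow_eq_cfc_rpow hρ (by positivity),
    mpow_eq_cfc_rpow (posSemidef_sandwich (cfc_isHermitian _ _) hσ) hz, sandTr]

theorem Qaz_eq_of_one_lt {α : ℝ} (h1 : 1 < α) {ρ σ : Matrix ι ι ℂ}
    (hρ : ρ.PosSemidef) (hσ : σ.PosSemidef) :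
    Qaz α (α - 1) ρ σ =
      sandTr (α - 1) (cfc (fun x : ℝ => x ^ (α / (2 * (α - 1)))) ρ) (pinv σ) := by
  have hz : 0 < α - 1 := sub_pos.2 h1
  have h0 : 0 < α := by linarith
  have e : (1 - α) / (α - 1) = -1 := by rw [div_eq_iff hz.ne']; ring
  rw [Qaz, e, mpow_neg_one hσ, mpow_eq_cfc_rpow hρ (by positivity), ← pinv,
    mpow_eq_cfc_rpow (posSemidef_sandwich (cfc_isHermitian _ _) (posSemidef_pinv hσ)) hz, sandTr]

theorem overlap_iff {ρ σ : Matrix ι ι ℂ} (hρ : IsState ρ) (hσ : σ.PosSemidef) :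
    ((ρ * σ).trace ≠ 0 ∨ msupp ρ ≤ msupp σ) ↔ σ * ρ ≠ 0 := by
  constructor
  · rintro (h | h) h0
    · exact h (by rw [trace_mul_comm, h0, trace_zero])
    · have h1 := eq_mul_of_kerProj_mul_eq_zero hσ.1 ((msupp_le_iff hσ.1).1 h)
      refine hρ.ne_zero (conjTranspose_mul_self_eq_zero.1 ?_)
      conv_lhs => enter [1]; rw [h1]
      rw [conjTranspose_mul, hσ.1.eq, mul_assoc, h0, mul_zero]
  · intro h
    refine Or.inl fun h0 => h ?_
    set B := cfc (fun x : ℝ => x ^ (1 / 2 : ℝ)) ρ with hB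
    have hBB : B * B = ρ := by
      have := cfc_rpow_mul_cfc_rpow hρ.1 (p := 1 / 2) (by norm_num)
      rwa [show (1 - 1 / 2 : ℝ) = 1 / 2 by norm_num] at this
    have hBH : B.IsHermitian := cfc_isHermitian _ _
    have h1 : (B * σ * B).trace = 0 := by
      rw [trace_mul_comm, ← mul_assoc, hBB, h0]
    have h2 := mul_eq_zero_of_sandwich_eq_zero hBH hσ
      (((posSemidef_sandwich hBH hσ).trace_eq_zero_iff).1 h1)
    rw [← hBB, ← mul_assoc, h2, zero_mul]

theorem Daz_eq_of_lt_one {α : ℝ} (h0 : 0 < α) (h1 : α < 1) {ρ σ : Matrix ι ι ℂ}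
    (hρ : IsState ρ) (hσ : σ.PosSemidef) :
    Daz α (1 - α) ρ σ = if σ * ρ ≠ 0 then (((α - 1)⁻¹ * Real.log
      (sandTr (1 - α) (cfc (fun x : ℝ => x ^ (α / (2 * (1 - α)))) ρ) σ) : ℝ) : EReal) else ⊤ := by
  rw [Daz, Qaz_eq_of_lt_one h0 h1 hρ.1 hσ]
  refine if_congr ?_ rfl rfl
  rw [← overlap_iff hρ hσ]
  simp [h1]

theorem Daz_eq_of_one_lt {α : ℝ} (h1 : 1 < α) {ρ σ : Matrix ι ι ℂ}
    (hρ : ρ.PosSemidef) (hσ : σ.PosSemidef) :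
    Daz α (α - 1) ρ σ = if msupp ρ ≤ msupp σ then (((α - 1)⁻¹ * Real.log
      (sandTr (α - 1) (cfc (fun x : ℝ => x ^ (α / (2 * (α - 1)))) ρ) (pinv σ)) : ℝ) : EReal)
      else ⊤ := by
  rw [Daz, Qaz_eq_of_one_lt h1 hρ hσ]
  refine if_congr ?_ rfl rfl
  simp [h1.not_gt]

theorem additivity_of_lt_one {d₁ d₂ : ℕ} (hd₁ : 1 ≤ d₁) (hd₂ : 1 ≤ d₂)
    {α : ℝ} (h0 : 0 < α) (h1 : α < 1)
    {ρ₁ : Matrix (Fin d₁) (Fin d₁) ℂ} {ρ₂ : Matrix (Fin d₂) (Fin d₂) ℂ}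
    (hρ₁ : IsState ρ₁) (hρ₂ : IsState ρ₂)
    {S : (d : ℕ) → Set (Matrix (Fin d) (Fin d) ℂ)} (hS : Assumption1' S)
    (hsupp₁ : ∃ τ ∈ S d₁, IsState τ ∧ msupp ρ₁ ≤ msupp τ)
    (hsupp₂ : ∃ τ ∈ S d₂, IsState τ ∧ msupp ρ₂ ≤ msupp τ) :
    (⨅ σ ∈ S (d₁ * d₂), Daz α (1 - α) (dtens ρ₁ ρ₂) σ) =
      (⨅ σ ∈ S d₁, Daz α (1 - α) ρ₁ σ) + ⨅ σ ∈ S d₂, Daz α (1 - α) ρ₂ σ := by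
  have hz : 0 < 1 - α := sub_pos.2 h1
  have hd : 1 ≤ d₁ * d₂ := Nat.mul_pos hd₁ hd₂
  have hp : α / (2 * (1 - α)) ≠ 0 := by positivity
  have hρ := isState_dtens hρ₁ hρ₂
  have hiff : ∀ {d : ℕ} {ρ σ : Matrix (Fin d) (Fin d) ℂ}, IsState ρ → σ.PosSemidef →
      (sandTr (1 - α) (cfc (fun x : ℝ => x ^ (α / (2 * (1 - α)))) ρ) σ = 0 ↔ σ * ρ = 0) :=
    fun hρ hσ => (sandTr_eq_zero_iff hz.ne' (cfc_isHermitian _ _) hσ).trans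
      (mul_cfc_rpow_eq_zero_iff hρ.1 hp _)
  have hmul : ∀ σ ∈ S d₁, ∀ τ ∈ S d₂,
      sandTr (1 - α) (cfc (fun x : ℝ => x ^ (α / (2 * (1 - α)))) (dtens ρ₁ ρ₂)) (dtens σ τ) =
      sandTr (1 - α) (cfc (fun x : ℝ => x ^ (α / (2 * (1 - α)))) ρ₁) σ *
      sandTr (1 - α) (cfc (fun x : ℝ => x ^ (α / (2 * (1 - α)))) ρ₂) τ := by
    intro σ hσ τ hτ
    rw [cfc_rpow_dtens hρ₁.1 hρ₂.1, sandTr_dtens _ (cfc_isHermitian _ _) (cfc_isHermitian _ _)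
      (hS.psd _ hd₁ σ hσ) (hS.psd _ hd₂ τ hτ)]
  refine iInf_additive (fun σ hσ => Daz_eq_of_lt_one h0 h1 hρ₁ (hS.psd _ hd₁ σ hσ))
    (fun σ hσ => Daz_eq_of_lt_one h0 h1 hρ₂ (hS.psd _ hd₂ σ hσ))
    (fun σ hσ => Daz_eq_of_lt_one h0 h1 hρ (hS.psd _ hd σ hσ))
    dtens (fun σ hσ τ hτ => hS.tens d₁ d₂ hd₁ hd₂ σ hσ τ hτ)
    (fun σ hσ h => (hiff hρ₁ (hS.psd _ hd₁ σ hσ)).not.2 h)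
    (fun σ hσ h => (hiff hρ₂ (hS.psd _ hd₂ σ hσ)).not.2 h) ?_ ?_ ?_ ?_
  · intro σ hσ τ hτ hg₁ hg₂
    refine ⟨?_, hmul σ hσ τ hτ⟩
    have pσ := hS.psd _ hd₁ σ hσ
    have pτ := hS.psd _ hd₂ τ hτ
    refine (hiff hρ (posSemidef_dtens pσ pτ)).not.1 ?_
    rw [hmul σ hσ τ hτ]
    exact mul_ne_zero ((hiff hρ₁ pσ).not.2 hg₁) ((hiff hρ₂ pτ).not.2 hg₂)
  · obtain ⟨τ₁, hτ₁, -⟩ := hsupp₁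
    obtain ⟨τ₂, hτ₂, -⟩ := hsupp₂
    obtain ⟨σ, hσ, τ, hτ, h⟩ := sandTr_bound hd₁ hd₂ hz (by linarith)
      (cfc_rpow_posSemidef hρ₁.1 (α / (2 * (1 - α)))) (cfc_rpow_posSemidef hρ₂.1 (α / (2 * (1 - α))))
      hS ⟨τ₁, hτ₁⟩ ⟨τ₂, hτ₂⟩
    refine ⟨σ, hσ, τ, hτ, fun X hX hg => ?_⟩
    have pX := hS.psd _ hd X hX
    have hle := h X hX
    rw [← cfc_rpow_dtens hρ₁.1 hρ₂.1] at hle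
    have hpos := lt_of_le_of_ne (sandTr_nonneg _ (cfc_isHermitian _ _) pX)
      (Ne.symm ((hiff hρ pX).not.2 hg))
    have hne := mul_ne_zero_iff.1 (hpos.trans_le hle).ne'
    refine ⟨(hiff hρ₁ (hS.psd _ hd₁ σ hσ)).not.1 hne.1, (hiff hρ₂ (hS.psd _ hd₂ τ hτ)).not.1 hne.2,
      mul_le_mul_of_nonpos_left (Real.log_le_log hpos hle) ?_⟩
    exact inv_nonpos.2 (by linarith)
  · obtain ⟨τ, hτ, -, h⟩ := hsupp₁
    exact ⟨τ, hτ, (overlap_iff hρ₁ (hS.psd _ hd₁ τ hτ)).1 (Or.inr h)⟩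
  · obtain ⟨τ, hτ, -, h⟩ := hsupp₂
    exact ⟨τ, hτ, (overlap_iff hρ₂ (hS.psd _ hd₂ τ hτ)).1 (Or.inr h)⟩

theorem additivity_of_one_lt {d₁ d₂ : ℕ} (hd₁ : 1 ≤ d₁) (hd₂ : 1 ≤ d₂)
    {α : ℝ} (h2 : 2 ≤ α)
    {ρ₁ : Matrix (Fin d₁) (Fin d₁) ℂ} {ρ₂ : Matrix (Fin d₂) (Fin d₂) ℂ}
    (hρ₁ : IsState ρ₁) (hρ₂ : IsState ρ₂)
    {S : (d : ℕ) → Set (Matrix (Fin d) (Fin d) ℂ)} (hS : Assumption1' S)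
    (hsupp₁ : ∃ τ ∈ S d₁, IsState τ ∧ msupp ρ₁ ≤ msupp τ)
    (hsupp₂ : ∃ τ ∈ S d₂, IsState τ ∧ msupp ρ₂ ≤ msupp τ) :
    (⨅ σ ∈ S (d₁ * d₂), Daz α (α - 1) (dtens ρ₁ ρ₂) σ) =
      (⨅ σ ∈ S d₁, Daz α (α - 1) ρ₁ σ) + ⨅ σ ∈ S d₂, Daz α (α - 1) ρ₂ σ := by
  have hz : 0 < α - 1 := by linarith
  have h0 : 0 < α := by linarith
  have h1 : 1 < α := by linarith
  have hd : 1 ≤ d₁ * d₂ := Nat.mul_pos hd₁ hd₂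
  have hp : α / (2 * (α - 1)) ≠ 0 := by positivity
  have hρ := isState_dtens hρ₁ hρ₂
  have hiff : ∀ {d : ℕ} {ρ σ : Matrix (Fin d) (Fin d) ℂ}, IsState ρ → σ.PosSemidef →
      (msupp ρ ≤ msupp σ ↔
        kerProj σ * cfc (fun x : ℝ => x ^ (α / (2 * (α - 1)))) ρ = 0) :=
    fun hρ hσ => (msupp_le_iff hσ.1).trans (mul_cfc_rpow_eq_zero_iff hρ.1 hp _).symm
  have hne : ∀ {d : ℕ} {ρ σ : Matrix (Fin d) (Fin d) ℂ}, IsState ρ → σ.PosSemidef →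
      msupp ρ ≤ msupp σ →
      sandTr (α - 1) (cfc (fun x : ℝ => x ^ (α / (2 * (α - 1)))) ρ) (pinv σ) ≠ 0 := by
    intro d ρ σ hρ hσ h h'
    have h3 := (sandTr_eq_zero_iff hz.ne' (cfc_isHermitian _ _) (posSemidef_pinv hσ)).1 h'
    refine cfc_rpow_ne_zero hρ hp ?_
    rw [eq_mul_of_kerProj_mul_eq_zero hσ.1 ((hiff hρ hσ).1 h), ← pinv, h3, mul_zero]
  refine iInf_additive (fun σ hσ => Daz_eq_of_one_lt h1 hρ₁.1 (hS.psd _ hd₁ σ hσ))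
    (fun σ hσ => Daz_eq_of_one_lt h1 hρ₂.1 (hS.psd _ hd₂ σ hσ))
    (fun σ hσ => Daz_eq_of_one_lt h1 hρ.1 (hS.psd _ hd σ hσ))
    dtens (fun σ hσ τ hτ => hS.tens d₁ d₂ hd₁ hd₂ σ hσ τ hτ)
    (fun σ hσ h => hne hρ₁ (hS.psd _ hd₁ σ hσ) h)
    (fun σ hσ h => hne hρ₂ (hS.psd _ hd₂ σ hσ) h) ?_ ?_ ?_ ?_
  · intro σ hσ τ hτ hg₁ hg₂
    have pσ := hS.psd _ hd₁ σ hσ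
    have pτ := hS.psd _ hd₂ τ hτ
    refine ⟨msupp_dtens_le pσ.1 pτ.1 hg₁ hg₂, ?_⟩
    rw [cfc_rpow_dtens hρ₁.1 hρ₂.1, sandTr_pinv_dtens _ (cfc_isHermitian _ _)
      (cfc_isHermitian _ _) pσ pτ]
  · obtain ⟨τ₁, hτ₁, -⟩ := hsupp₁
    obtain ⟨τ₂, hτ₂, -⟩ := hsupp₂
    obtain ⟨σ, hσ, τ, hτ, h⟩ := exists_sandTr_pinv_mul_le hd₁ hd₂ (z := α - 1) (by linarith)
      (cfc_isHermitian _ _) (cfc_isHermitian _ _) (cfc_rpow_ne_zero hρ₁ hp)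
      (cfc_rpow_ne_zero hρ₂ hp) hS ⟨τ₁, hτ₁⟩ ⟨τ₂, hτ₂⟩
    refine ⟨σ, hσ, τ, hτ, fun X hX hg => ?_⟩
    have pX := hS.psd _ hd X hX
    have pσ := hS.psd _ hd₁ σ hσ
    have pτ := hS.psd _ hd₂ τ hτ
    have h3 := h X hX
    rw [← cfc_rpow_dtens hρ₁.1 hρ₂.1] at h3
    obtain ⟨h4, h5, h6⟩ := h3 ((hiff hρ pX).1 hg)
    have g₁ := (hiff hρ₁ pσ).2 h4
    have g₂ := (hiff hρ₂ pτ).2 h5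
    have hpos₁ := lt_of_le_of_ne (sandTr_nonneg _ (cfc_isHermitian _ _) (posSemidef_pinv pσ))
      (hne hρ₁ pσ g₁).symm
    have hpos₂ := lt_of_le_of_ne (sandTr_nonneg _ (cfc_isHermitian _ _) (posSemidef_pinv pτ))
      (hne hρ₂ pτ g₂).symm
    exact ⟨g₁, g₂, mul_le_mul_of_nonneg_left (Real.log_le_log (mul_pos hpos₁ hpos₂) h6)
      (inv_nonneg.2 hz.le)⟩
  · obtain ⟨τ, hτ, -, h⟩ := hsupp₁
    exact ⟨τ, hτ, h⟩
  · obtain ⟨τ, hτ, -, h⟩ := hsupp₂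
    exact ⟨τ, hτ, h⟩

end Renyi

end QHT

namespace QHT

/-- Theorem 19 of the paper: additivity of the minimized `α`-`z` Rényi
relative entropy on the boundary line `|1-α|/z = 1`. -/
theorem az_additivity_on_boundary_line {d₁ d₂ : ℕ} (hd₁ : 1 ≤ d₁) (hd₂ : 1 ≤ d₂)
    (α z : ℝ) (hαz : (α, z) ∈ Dregion) (hz : |1 - α| / z = 1)
    (ρ₁ : Matrix (Fin d₁) (Fin d₁) ℂ) (ρ₂ : Matrix (Fin d₂) (Fin d₂) ℂ)
    (hρ₁ : IsState ρ₁) (hρ₂ : IsState ρ₂)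
    (S : (d : ℕ) → Set (Matrix (Fin d) (Fin d) ℂ)) (hS : Assumption1' S)
    (hsupp₁ : ∃ τ ∈ S d₁, IsState τ ∧ msupp ρ₁ ≤ msupp τ)
    (hsupp₂ : ∃ τ ∈ S d₂, IsState τ ∧ msupp ρ₂ ≤ msupp τ) :
    (⨅ σ ∈ S (d₁ * d₂), Daz α z (dtens ρ₁ ρ₂) σ) =
      (⨅ σ ∈ S d₁, Daz α z ρ₁ σ) + ⨅ σ ∈ S d₂, Daz α z ρ₂ σ := by
  have hz0 : z ≠ 0 := by
    rintro rfl
    simp at hz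
  rw [div_eq_one_iff_eq hz0] at hz
  rcases hαz with ⟨h0, h1, -⟩ | ⟨h1, h2, -⟩ | ⟨h1, -⟩
  · dsimp only at h0 h1
    rw [abs_of_pos (sub_pos.2 h1)] at hz
    subst hz
    exact additivity_of_lt_one hd₁ hd₂ h0 h1 hρ₁ hρ₂ hS hsupp₁ hsupp₂
  · dsimp only at h1 h2
    rw [abs_of_neg (sub_neg.2 h1), neg_sub] at hz
    subst hz
    have := (le_max_left _ _).trans h2
    exact additivity_of_one_lt hd₁ hd₂ (by linarith) hρ₁ hρ₂ hS hsupp₁ hsupp₂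
  · dsimp only at h1
    subst h1
    simp at hz
    exact absurd hz.symm hz0

end QHT
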